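/- arXiv:2001.10712 — 10 statements merged into one kernel-verified Lean document; each statement's English description precedes it below -/
import Mathlib

section
/- A pair (e₁, e₂) of elements of 𝔹 is a biharmonic basis if and only if there exist complex numbers α₁, β₁, β₂ with α₁ ≠ 0 and β₁ ≠ β₂, and a sign σ ∈ {1, −1}, such that e₁ = α₁·1 + β₁·ε and e₂ = σ·i·(α₁·1 + β₂·ε). -/
open Complex Filter Topology DualNumber

noncomputable section

/-- The biharmonic algebra `𝔹`: the dual numbers over `ℂ`, with `e = 1` and `ρ = ε`. -/
abbrev Biharm : Type := DualNumber ℂ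

/-- A pair `(e₁, e₂)` is a biharmonic basis of `𝔹`: the pair is linearly independent over
`ℂ` and satisfies `(e₁² + e₂²)² = 0`, `e₁² + e₂² ≠ 0`. -/
def IsBiharmonicBasis (e₁ e₂ : Biharm) : Prop :=
  LinearIndependent ℂ ![e₁, e₂] ∧ (e₁ ^ 2 + e₂ ^ 2) ^ 2 = 0 ∧ e₁ ^ 2 + e₂ ^ 2 ≠ 0

/-- The biharmonic plane `μ_{e₁,e₂} = {x e₁ + y e₂ : x, y ∈ ℝ}`. -/
def biharmPlane (e₁ e₂ : Biharm) : Set Biharm :=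
  {ζ | ∃ x y : ℝ, ζ = (x : ℂ) • e₁ + (y : ℂ) • e₂}

/-- The embedding `(x, y) ↦ x e₁ + y e₂` of `ℝ²` into `𝔹`. -/
def emb (e₁ e₂ : Biharm) (p : ℝ × ℝ) : Biharm := (p.1 : ℂ) • e₁ + (p.2 : ℂ) • e₂

/-- `Φ` has monogenic derivative `d` at `ζ`: the difference quotient
`(Φ(ζ + h) - Φ(ζ)) h⁻¹` tends to `d` as `h → 0` along the nonzero elements of
the biharmonic plane `μ_{e₁,e₂}`. -/
def HasMonoDerivAt (e₁ e₂ : Biharm) (Φ : Biharm → Biharm) (d ζ : Biharm) : Prop :=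
  Tendsto (fun h => (Φ (ζ + h) - Φ ζ) * Ring.inverse h)
    (𝓝[biharmPlane e₁ e₂ \ {0}] 0) (𝓝 d)

/-- `Φ` is monogenic on `Dζ`: it has a monogenic derivative at every point of `Dζ`. -/
def MonogenicOn (e₁ e₂ : Biharm) (Φ : Biharm → Biharm) (Dζ : Set Biharm) : Prop :=
  ∀ ζ ∈ Dζ, ∃ d, HasMonoDerivAt e₁ e₂ Φ d ζ

theorem Biharm.sq_add_sq (x y : Biharm) :
    x ^ 2 + y ^ 2 = (x.fst ^ 2 + y.fst ^ 2) • (1 : Biharm) +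
      (2 * (x.fst * x.snd + y.fst * y.snd)) • ε := by
  ext
  · simp [pow_two]
  · simp [pow_two]
    ring

theorem Biharm.sq_eq_zero_iff (x : Biharm) : x ^ 2 = 0 ↔ x.fst = 0 := by
  rw [TrivSqZeroExt.ext_iff]
  simp +contextual [pow_two]

theorem Biharm.linearIndependent_pair {x y : Biharm}
    (h : x.fst * y.snd - x.snd * y.fst ≠ 0) : LinearIndependent ℂ ![x, y] := by
  rw [LinearIndependent.pair_iff]
  intro s t hst
  have h₁ : s * x.fst + t * y.fst = 0 := by simpa using congrArg TrivSqZeroExt.fst hst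
  have h₂ : s * x.snd + t * y.snd = 0 := by simpa using congrArg TrivSqZeroExt.snd hst
  constructor
  · refine (mul_eq_zero.mp ?_).resolve_right h
    linear_combination y.snd * h₁ - y.fst * h₂
  · refine (mul_eq_zero.mp ?_).resolve_right h
    linear_combination x.fst * h₂ - x.snd * h₁

/-- A pair `(e₁, e₂)` of elements of `𝔹` is a biharmonic basis if and only if
`e₁ = α₁·1 + β₁·ε`, `e₂ = σ·i·(α₁·1 + β₂·ε)` for some complex `α₁ ≠ 0`, `β₁ ≠ β₂`
and a sign `σ ∈ {1, -1}`. -/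
theorem biharmonicBasis_iff_rep (e₁ e₂ : Biharm) :
    IsBiharmonicBasis e₁ e₂ ↔
      ∃ α₁ β₁ β₂ σ : ℂ, (σ = 1 ∨ σ = -1) ∧ α₁ ≠ 0 ∧ β₁ ≠ β₂ ∧
        e₁ = α₁ • (1 : Biharm) + β₁ • ε ∧
        e₂ = (σ * Complex.I) • (α₁ • (1 : Biharm) + β₂ • ε) := by
  constructor
  · rintro ⟨-, h₁, h₂⟩
    rw [Biharm.sq_eq_zero_iff] at h₁
    rw [Biharm.sq_add_sq] at h₁ h₂
    replace h₁ : e₁.fst ^ 2 + e₂.fst ^ 2 = 0 := by simpa using h₁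
    have h₃ : e₁.fst * e₁.snd + e₂.fst * e₂.snd ≠ 0 := by
      intro h
      simp [h₁, h] at h₂
    obtain ⟨σ, hσ, hc⟩ : ∃ σ : ℂ, (σ = 1 ∨ σ = -1) ∧ e₂.fst = σ * I * e₁.fst := by
      have : (e₂.fst - I * e₁.fst) * (e₂.fst + I * e₁.fst) = 0 := by
        linear_combination h₁ - e₁.fst ^ 2 * I_sq
      rcases mul_eq_zero.mp this with h | h
      · exact ⟨1, Or.inl rfl, by linear_combination h⟩
      · exact ⟨-1, Or.inr rfl, by linear_combination h⟩
    have hσ2 : σ ^ 2 = 1 := by rcases hσ with rfl | rfl <;> norm_num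
    have hd : e₂.snd = σ * I * (-(σ * I) * e₂.snd) := by
      linear_combination e₂.snd * (-hσ2 + σ ^ 2 * I_sq)
    refine ⟨e₁.fst, e₁.snd, -(σ * I) * e₂.snd, σ, hσ, ?_, ?_, ?_, ?_⟩
    · intro h
      simp [hc, h] at h₃
    · intro h
      apply h₃
      rw [hc, h]
      ring
    · ext <;> simp
    · ext
      · simpa using hc
      · simpa using hd
  · rintro ⟨a, b, d, σ, hσ, ha, hbd, rfl, rfl⟩
    have hσ2 : σ ^ 2 = 1 := by rcases hσ with rfl | rfl <;> norm_num
    have hσ0 : σ ≠ 0 := by rintro rfl; norm_num at hσ2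
    refine ⟨Biharm.linearIndependent_pair ?_, ?_, ?_⟩
    · have : σ * I * a * (d - b) ≠ 0 :=
        mul_ne_zero (mul_ne_zero (mul_ne_zero hσ0 I_ne_zero) ha) (sub_ne_zero.mpr hbd.symm)
      convert this using 1
      simp
      ring
    · rw [Biharm.sq_eq_zero_iff, Biharm.sq_add_sq]
      simp
      linear_combination a ^ 2 * (σ ^ 2 * I_sq - hσ2)
    · intro h
      have h₂ := congrArg TrivSqZeroExt.snd h
      rw [Biharm.sq_add_sq] at h₂
      have : a * (b - d) = 0 := by
        simp at h₂
        linear_combination h₂ - a * d * (σ ^ 2 * I_sq - hσ2)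
      exact mul_ne_zero ha (sub_ne_zero.mpr hbd) this
end
end

section
/- Let (e₁, e₂) be a biharmonic basis of 𝔹. Then the biharmonic plane μ_{e₁,e₂} contains no nonzero zero-divisors: for all real numbers x, y with (x, y) ≠ (0, 0), the element x e₁ + y e₂ is invertible in 𝔹 (i.e., it is a unit of the ring 𝔹). -/
open Complex Filter Topology DualNumber

noncomputable section

/-- The scalar parts of a biharmonic basis satisfy `a² + b² = 0`. -/
theorem IsBiharmonicBasis.fst_sq_add_fst_sq {e₁ e₂ : Biharm} (h : IsBiharmonicBasis e₁ e₂) :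
    e₁.fst ^ 2 + e₂.fst ^ 2 = 0 := by
  have h' := congrArg TrivSqZeroExt.fst h.2.1
  simpa using h'

/-- The scalar part of the first element of a biharmonic basis is nonzero. -/
theorem IsBiharmonicBasis.fst_ne_zero {e₁ e₂ : Biharm} (h : IsBiharmonicBasis e₁ e₂) :
    e₁.fst ≠ 0 := by
  intro h₁
  have h₂ : e₂.fst = 0 := by simpa [h₁] using h.fst_sq_add_fst_sq
  apply h.2.2
  ext <;> simp [pow_two, h₁, h₂]

/-- For a biharmonic basis `(e₁, e₂)`, every nonzero element `x e₁ + y e₂` of the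
biharmonic plane `μ_{e₁,e₂}` is invertible in `𝔹`. -/
theorem biharmPlane_isUnit (e₁ e₂ : Biharm) (h : IsBiharmonicBasis e₁ e₂)
    (x y : ℝ) (hxy : (x, y) ≠ ((0 : ℝ), (0 : ℝ))) :
    IsUnit ((x : ℂ) • e₁ + (y : ℂ) • e₂) := by
  rw [TrivSqZeroExt.isUnit_iff_isUnit_fst, isUnit_iff_ne_zero]
  intro h₀
  simp only [TrivSqZeroExt.fst_add, TrivSqZeroExt.fst_smul, smul_eq_mul] at h₀
  have hmul : ((x : ℂ) ^ 2 + (y : ℂ) ^ 2) * e₁.fst ^ 2 = 0 := by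
    linear_combination (x * e₁.fst - y * e₂.fst) * h₀ + (y : ℂ) ^ 2 * h.fst_sq_add_fst_sq
  have hsum : x ^ 2 + y ^ 2 = 0 := by
    exact_mod_cast (mul_eq_zero.mp hmul).resolve_right (pow_ne_zero 2 h.fst_ne_zero)
  apply hxy
  rw [Prod.mk.injEq]
  constructor <;> nlinarith [sq_nonneg x, sq_nonneg y]
end
end

section
/- Let (e₁, e₂) be a biharmonic basis of 𝔹, let D ⊆ ℝ² be an open set and D_ζ := {x e₁ + y e₂ : (x,y) ∈ D}. A function Φ : D_ζ → 𝔹 is monogenic in D_ζ if and only if the map Φ̂ : D → 𝔹, Φ̂(x,y) := Φ(x e₁ + y e₂), is (Fréchet) differentiable as a map from ℝ² into the four-dimensional real vector space 𝔹 at every point of D and satisfies the Cauchy–Riemann type condition (∂Φ̂/∂y)(x,y) · e₁ = (∂Φ̂/∂x)(x,y) · e₂ for all (x,y) ∈ D. -/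
open Complex Filter Topology DualNumber

noncomputable section

/-- The embedding `emb` as a continuous real-linear map. -/
def embCLM (e₁ e₂ : Biharm) : ℝ × ℝ →L[ℝ] Biharm :=
  (ContinuousLinearMap.fst ℝ ℝ ℝ).smulRight e₁ + (ContinuousLinearMap.snd ℝ ℝ ℝ).smulRight e₂

theorem embCLM_apply (e₁ e₂ : Biharm) (p : ℝ × ℝ) : embCLM e₁ e₂ p = emb e₁ e₂ p := by
  ext <;> simp [embCLM, emb, -Complex.coe_smul]

theorem emb_zero (e₁ e₂ : Biharm) : emb e₁ e₂ 0 = 0 := by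
  rw [← embCLM_apply, map_zero]

theorem fst_emb (e₁ e₂ : Biharm) (p : ℝ × ℝ) :
    (emb e₁ e₂ p).fst = p.1 * e₁.fst + p.2 * e₂.fst := by
  simp [emb, -Complex.coe_smul]

theorem biharmPlane_eq_range (e₁ e₂ : Biharm) :
    biharmPlane e₁ e₂ = Set.range (emb e₁ e₂) := by
  ext ζ
  simp [biharmPlane, emb, eq_comm]

/-- The inverse of a dual number with nonzero scalar part is its ring inverse. -/
theorem ring_inverse_eq_inv {ζ : Biharm} (hζ : ζ.fst ≠ 0) : Ring.inverse ζ = ζ⁻¹ := by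
  have hu : IsUnit ζ := TrivSqZeroExt.isUnit_iff_isUnit_fst.mpr hζ.isUnit
  rw [← Ring.inverse_mul_cancel_left ζ ζ⁻¹ hu, TrivSqZeroExt.mul_inv_cancel hζ, mul_one]

namespace IsBiharmonicBasis

variable {e₁ e₂ : Biharm}

theorem fst_sq_add_sq (h : IsBiharmonicBasis e₁ e₂) : e₁.fst ^ 2 + e₂.fst ^ 2 = 0 := by
  simpa using congrArg TrivSqZeroExt.fst h.2.1

theorem fst_left_ne_zero (h : IsBiharmonicBasis e₁ e₂) : e₁.fst ≠ 0 := by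
  intro h₁
  have h₂ : e₂.fst = 0 := by simpa [h₁] using h.fst_sq_add_sq
  apply h.2.2
  ext <;> simp [pow_two, h₁, h₂]

theorem fst_right_eq (h : IsBiharmonicBasis e₁ e₂) :
    e₂.fst = I * e₁.fst ∨ e₂.fst = -I * e₁.fst := by
  have : (e₂.fst - I * e₁.fst) * (e₂.fst + I * e₁.fst) = 0 := by
    linear_combination h.fst_sq_add_sq - e₁.fst ^ 2 * I_sq
  rcases mul_eq_zero.mp this with h' | h'
  · exact Or.inl (by linear_combination h')
  · exact Or.inr (by linear_combination h')

theorem mul_norm_le_norm_fst_emb (h : IsBiharmonicBasis e₁ e₂) (p : ℝ × ℝ) :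
    ‖e₁.fst‖ * ‖p‖ ≤ ‖(emb e₁ e₂ p).fst‖ := by
  obtain ⟨z, hz, hre, him⟩ : ∃ z : ℂ, (emb e₁ e₂ p).fst = e₁.fst * z ∧
      |p.1| = |z.re| ∧ |p.2| = |z.im| := by
    rcases h.fst_right_eq with h' | h'
    · exact ⟨p.1 + I * p.2, by rw [fst_emb, h']; ring, by simp, by simp⟩
    · exact ⟨p.1 - I * p.2, by rw [fst_emb, h']; ring, by simp, by simp⟩
  rw [hz, norm_mul, Prod.norm_def, Real.norm_eq_abs, Real.norm_eq_abs, hre, him]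
  gcongr
  exact max_le (abs_re_le_norm z) (abs_im_le_norm z)

theorem fst_emb_ne_zero (h : IsBiharmonicBasis e₁ e₂) {p : ℝ × ℝ} (hp : p ≠ 0) :
    (emb e₁ e₂ p).fst ≠ 0 := by
  have h₁ := norm_pos_iff.mpr h.fst_left_ne_zero
  have h₂ := norm_pos_iff.mpr hp
  exact norm_pos_iff.mp ((mul_pos h₁ h₂).trans_le (h.mul_norm_le_norm_fst_emb p))

theorem isUnit_emb (h : IsBiharmonicBasis e₁ e₂) {p : ℝ × ℝ} (hp : p ≠ 0) :
    IsUnit (emb e₁ e₂ p) :=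
  TrivSqZeroExt.isUnit_iff_isUnit_fst.mpr (h.fst_emb_ne_zero hp).isUnit

theorem isUnit_left (h : IsBiharmonicBasis e₁ e₂) : IsUnit e₁ :=
  TrivSqZeroExt.isUnit_iff_isUnit_fst.mpr h.fst_left_ne_zero.isUnit

theorem norm_inverse_emb_le (h : IsBiharmonicBasis e₁ e₂) {p : ℝ × ℝ} (hp : p ≠ 0) :
    ‖Ring.inverse (emb e₁ e₂ p)‖ ≤
      (‖e₁.fst‖⁻¹ + ‖e₁.fst‖⁻¹ ^ 2 * ‖embCLM e₁ e₂‖) * ‖p‖⁻¹ := by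
  have ha := norm_pos_iff.mpr h.fst_left_ne_zero
  have hn := norm_pos_iff.mpr hp
  have hfst : ‖(emb e₁ e₂ p).fst‖⁻¹ ≤ ‖e₁.fst‖⁻¹ * ‖p‖⁻¹ := by
    rw [← mul_inv]
    exact inv_anti₀ (mul_pos ha hn) (h.mul_norm_le_norm_fst_emb p)
  have hsnd : ‖(emb e₁ e₂ p).snd‖ ≤ ‖embCLM e₁ e₂‖ * ‖p‖ := by
    refine le_trans ?_ ((embCLM e₁ e₂).le_opNorm p)
    rw [embCLM_apply, TrivSqZeroExt.norm_def]
    exact le_add_of_nonneg_left (norm_nonneg _)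
  rw [ring_inverse_eq_inv (h.fst_emb_ne_zero hp), TrivSqZeroExt.norm_def,
    TrivSqZeroExt.fst_inv, TrivSqZeroExt.snd_inv, norm_neg, op_smul_eq_smul, norm_smul,
    norm_smul, norm_inv]
  calc
    _ ≤ ‖e₁.fst‖⁻¹ * ‖p‖⁻¹ +
        ‖e₁.fst‖⁻¹ * ‖p‖⁻¹ * (‖e₁.fst‖⁻¹ * ‖p‖⁻¹ * (‖embCLM e₁ e₂‖ * ‖p‖)) := by gcongr
    _ = _ := by field_simp

theorem map_emb_punctured_nhds (h : IsBiharmonicBasis e₁ e₂) :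
    map (emb e₁ e₂) (𝓝[≠] 0) = 𝓝[biharmPlane e₁ e₂ \ {0}] 0 := by
  have hcoe : ⇑(embCLM e₁ e₂) = emb e₁ e₂ := funext (embCLM_apply e₁ e₂)
  have hne {p : ℝ × ℝ} (hp : p ≠ 0) : emb e₁ e₂ p ≠ 0 := (h.isUnit_emb hp).ne_zero
  have hker : (embCLM e₁ e₂ : ℝ × ℝ →ₗ[ℝ] Biharm).ker = ⊥ := by
    rw [LinearMap.ker_eq_bot']
    intro p hp
    by_contra hp₀
    exact hne hp₀ (by rw [← embCLM_apply]; exact hp)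
  have hemb : IsInducing (emb e₁ e₂) :=
    hcoe ▸ (LinearMap.isClosedEmbedding_of_injective hker).isInducing
  rw [hemb.map_nhdsWithin_eq, emb_zero, biharmPlane_eq_range]
  congr 1
  ext ζ
  constructor
  · rintro ⟨p, hp, rfl⟩
    exact ⟨⟨p, rfl⟩, hne hp⟩
  · rintro ⟨⟨p, rfl⟩, hp⟩
    exact ⟨p, fun hp₀ => hp (by rw [hp₀]; exact emb_zero e₁ e₂), rfl⟩

/-- A monogenic derivative `d` is the same as a Fréchet derivative of the form
`v ↦ d * (v₁ e₁ + v₂ e₂)`. -/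
theorem hasMonoDerivAt_iff_hasFDerivAt (h : IsBiharmonicBasis e₁ e₂) (Φ : Biharm → Biharm)
    (d : Biharm) (p : ℝ × ℝ) :
    HasMonoDerivAt e₁ e₂ Φ d (emb e₁ e₂ p) ↔
      HasFDerivAt (fun q => Φ (emb e₁ e₂ q))
        ((ContinuousLinearMap.mul ℝ Biharm d).comp (embCLM e₁ e₂)) p := by
  set r : ℝ × ℝ → Biharm := fun k =>
    Φ (emb e₁ e₂ (p + k)) - Φ (emb e₁ e₂ p) - d * emb e₁ e₂ k with hr
  have hinv : (fun k => Ring.inverse (emb e₁ e₂ k)) =O[𝓝[≠] 0] fun k => ‖k‖⁻¹ := by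
    refine Asymptotics.IsBigO.of_bound
      (‖e₁.fst‖⁻¹ + ‖e₁.fst‖⁻¹ ^ 2 * ‖embCLM e₁ e₂‖) ?_
    filter_upwards [self_mem_nhdsWithin] with k hk
    simpa using h.norm_inverse_emb_le hk
  have hemb : emb e₁ e₂ =O[𝓝[≠] 0] fun k => ‖k‖ := by
    have hO := ((embCLM e₁ e₂).isBigO_id (𝓝[≠] 0)).norm_right
    rwa [funext (embCLM_apply e₁ e₂)] at hO
  have hmono : HasMonoDerivAt e₁ e₂ Φ d (emb e₁ e₂ p) ↔
      (fun k => r k * Ring.inverse (emb e₁ e₂ k)) =o[𝓝[≠] 0] fun _ => (1 : ℝ) := by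
    rw [HasMonoDerivAt, ← h.map_emb_punctured_nhds, tendsto_map'_iff,
      Asymptotics.isLittleO_one_iff, ← tendsto_sub_nhds_zero_iff]
    refine tendsto_congr' ?_
    filter_upwards [self_mem_nhdsWithin] with k hk
    have hadd : emb e₁ e₂ (p + k) = emb e₁ e₂ p + emb e₁ e₂ k := by
      simp_rw [← embCLM_apply, map_add]
    simp only [Function.comp_apply, hr, hadd]
    rw [sub_mul _ (d * _), mul_assoc, Ring.mul_inverse_cancel _ (h.isUnit_emb hk), mul_one]
  have hfderiv : HasFDerivAt (fun q => Φ (emb e₁ e₂ q))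
      ((ContinuousLinearMap.mul ℝ Biharm d).comp (embCLM e₁ e₂)) p ↔
        r =o[𝓝[≠] 0] fun k => ‖k‖ := by
    have hr₀ : r 0 = 0 := by simp [hr, emb_zero]
    rw [hasFDerivAt_iff_isLittleO_nhds_zero, Asymptotics.isLittleO_norm_right,
      ← Asymptotics.isLittleO_insert hr₀, Set.insert_eq, Set.union_compl_self, nhdsWithin_univ]
    simp [hr, embCLM_apply]
  rw [hmono, hfderiv]
  constructor
  · intro ho
    refine (ho.mul_isBigO hemb).congr' ?_ (by simp)
    filter_upwards [self_mem_nhdsWithin] with k hk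
    rw [mul_assoc, Ring.inverse_mul_cancel _ (h.isUnit_emb hk), mul_one]
  · intro ho
    refine (ho.mul_isBigO hinv).congr' EventuallyEq.rfl ?_
    filter_upwards [self_mem_nhdsWithin] with k hk
    exact mul_inv_cancel₀ (norm_ne_zero_iff.mpr hk)

end IsBiharmonicBasis

/-- Cauchy–Riemann type characterization of monogenic functions: `Φ` is monogenic on
`D_ζ` iff `Φ̂(x,y) = Φ(x e₁ + y e₂)` is Fréchet differentiable on the open set `D` and
`(∂Φ̂/∂y)·e₁ = (∂Φ̂/∂x)·e₂` on `D`. -/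
theorem monogenicOn_iff_cauchyRiemann (e₁ e₂ : Biharm) (h : IsBiharmonicBasis e₁ e₂)
    (D : Set (ℝ × ℝ)) (hD : IsOpen D) (Φ : Biharm → Biharm) :
    MonogenicOn e₁ e₂ Φ (emb e₁ e₂ '' D) ↔
      ((∀ p ∈ D, DifferentiableAt ℝ (fun q => Φ (emb e₁ e₂ q)) p) ∧
        ∀ p ∈ D,
          fderiv ℝ (fun q => Φ (emb e₁ e₂ q)) p ((0 : ℝ), (1 : ℝ)) * e₁ =
            fderiv ℝ (fun q => Φ (emb e₁ e₂ q)) p ((1 : ℝ), (0 : ℝ)) * e₂) := by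
  have hcomp (d : Biharm) (v : ℝ × ℝ) :
      (ContinuousLinearMap.mul ℝ Biharm d).comp (embCLM e₁ e₂) v = d * emb e₁ e₂ v := by
    simp [embCLM_apply]
  have h10 : emb e₁ e₂ (1, 0) = e₁ := by simp [emb]
  have h01 : emb e₁ e₂ (0, 1) = e₂ := by simp [emb]
  rw [← forall₂_and, MonogenicOn, Set.forall_mem_image]
  refine forall₂_congr fun p _ => ?_
  simp_rw [h.hasMonoDerivAt_iff_hasFDerivAt]
  constructor
  · rintro ⟨d, hd⟩
    refine ⟨hd.differentiableAt, ?_⟩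
    rw [hd.fderiv, hcomp, hcomp, h10, h01]
    ring
  · rintro ⟨hdiff, hCR⟩
    set f' := fderiv ℝ (fun q => Φ (emb e₁ e₂ q)) p
    refine ⟨f' (1, 0) * Ring.inverse e₁, hdiff.hasFDerivAt.congr_fderiv ?_⟩
    have hinv := Ring.inverse_mul_cancel _ h.isUnit_left
    ext1
    · ext1
      simp only [ContinuousLinearMap.comp_apply (f := ContinuousLinearMap.inl ℝ ℝ ℝ),
        ContinuousLinearMap.inl_apply, hcomp, h10]
      rw [mul_assoc, hinv, mul_one]
    · ext1
      simp only [ContinuousLinearMap.comp_apply (f := ContinuousLinearMap.inr ℝ ℝ ℝ),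
        ContinuousLinearMap.inr_apply, hcomp, h01]
      linear_combination Ring.inverse e₁ * hCR - f' (0, 1) * hinv
end
end

section
/- Let α₁, β₁, β₂ ∈ ℂ with α₁ ≠ 0 and β₁ ≠ β₂, let σ ∈ {1, −1}, and let e₁ = α₁·1 + β₁·ε, e₂ = σ·i·(α₁·1 + β₂·ε) be the corresponding biharmonic basis of 𝔹. Let D ⊆ ℝ² be an open connected set, D_ζ := {x e₁ + y e₂ : (x,y) ∈ D}, and D_Z := {α₁(x + σ i y) : (x,y) ∈ D} ⊆ ℂ. A function Φ : D_ζ → 𝔹 is monogenic in D_ζ if and only if there exist holomorphic functions F, F₀ on D_Z such that for all (x,y) ∈ D, writing Z = α₁(x + σ i y), one has Φ(x e₁ + y e₂) = F(Z)·1 + ( ((β₁/α₁)·Z + σ·i·(β₂ − β₁)·y)·F′(Z) + F₀(Z) )·ε. -/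
open Complex Filter Topology DualNumber

noncomputable section

/-- The point `Z + L(Z) ε` of the graph of `L` in `𝔹`. -/
def graphEmb (L : ℂ →L[ℝ] ℂ) (Z : ℂ) : Biharm :=
  TrivSqZeroExt.inl Z + TrivSqZeroExt.inr (L Z)

@[simp]
theorem fst_graphEmb (L : ℂ →L[ℝ] ℂ) (Z : ℂ) : (graphEmb L Z).fst = Z := by
  simp [graphEmb]

@[simp]
theorem snd_graphEmb (L : ℂ →L[ℝ] ℂ) (Z : ℂ) : (graphEmb L Z).snd = L Z := by
  simp [graphEmb]

theorem graphEmb_add (L : ℂ →L[ℝ] ℂ) (Z H : ℂ) :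
    graphEmb L (Z + H) = graphEmb L Z + graphEmb L H := by
  ext <;> simp

theorem isEmbedding_graphEmb (L : ℂ →L[ℝ] ℂ) : IsEmbedding (graphEmb L) := by
  have hc : Continuous (graphEmb L) :=
    (TrivSqZeroExt.continuous_inl.comp continuous_id).add
      (TrivSqZeroExt.continuous_inr.comp L.continuous)
  exact IsEmbedding.of_leftInverse (f := TrivSqZeroExt.fst) (fst_graphEmb L)
    TrivSqZeroExt.continuous_fst hc

theorem inverse_graphEmb (L : ℂ →L[ℝ] ℂ) {H : ℂ} (hH : H ≠ 0) :
    Ring.inverse (graphEmb L H) =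
      TrivSqZeroExt.inl H⁻¹ - TrivSqZeroExt.inr (H⁻¹ * (L H / H)) := by
  have h : graphEmb L H *
      (TrivSqZeroExt.inl H⁻¹ - TrivSqZeroExt.inr (H⁻¹ * (L H / H))) = 1 := by
    ext
    · simp [hH]
    · simp
      field_simp
      ring
  exact Ring.inverse_unit ⟨_, _, h, (mul_comm _ _).trans h⟩

theorem tendsto_nhds_iff_fst_snd {α : Type*} {f : α → Biharm} {l : Filter α} {d : Biharm} :
    Tendsto f l (𝓝 d) ↔ Tendsto (fun a => (f a).fst) l (𝓝 d.fst) ∧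
      Tendsto (fun a => (f a).snd) l (𝓝 d.snd) := by
  rw [TrivSqZeroExt.nhds_def]
  exact tendsto_prod_iff'

theorem nhdsWithin_range_graphEmb (L : ℂ →L[ℝ] ℂ) :
    𝓝[Set.range (graphEmb L) \ {0}] (0 : Biharm) = map (graphEmb L) (𝓝[≠] 0) := by
  have h0 : graphEmb L 0 = 0 := by ext <;> simp
  rw [(isEmbedding_graphEmb L).map_nhdsWithin_eq, h0]
  congr 1
  rw [Set.image_compl_eq_range_sdiff_image (isEmbedding_graphEmb L).injective,
    Set.image_singleton, h0]

/-- Along the graph of `L`, monogenic differentiability amounts to complex differentiability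
of the first component together with convergence of a corrected difference quotient of the
second component. -/
theorem hasMonoDerivAt_graphEmb_iff {e₁ e₂ : Biharm} {L : ℂ →L[ℝ] ℂ}
    (hL : biharmPlane e₁ e₂ = Set.range (graphEmb L)) (Φ : Biharm → Biharm) (d : Biharm) (Z : ℂ) :
    HasMonoDerivAt e₁ e₂ Φ d (graphEmb L Z) ↔
      HasDerivAt (fun W => (Φ (graphEmb L W)).fst) d.fst Z ∧
      Tendsto (fun H => H⁻¹ * ((Φ (graphEmb L (Z + H))).snd - (Φ (graphEmb L Z)).snd)
          - H⁻¹ * ((Φ (graphEmb L (Z + H))).fst - (Φ (graphEmb L Z)).fst) * (L H / H))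
        (𝓝[≠] 0) (𝓝 d.snd) := by
  rw [HasMonoDerivAt, hL, nhdsWithin_range_graphEmb, tendsto_map'_iff,
    tendsto_nhds_iff_fst_snd, hasDerivAt_iff_tendsto_slope_zero]
  refine and_congr (tendsto_congr' ?_) (tendsto_congr' ?_) <;>
    filter_upwards [self_mem_nhdsWithin] with H hH <;>
    simp only [Function.comp_apply, inverse_graphEmb L hH, ← graphEmb_add]
  · simp [mul_comm]
  · simp
    ring

theorem isBoundedUnder_norm_div_self (L : ℂ →L[ℝ] ℂ) (l : Filter ℂ) :
    l.IsBoundedUnder (· ≤ ·) (fun H => ‖L H / H‖) := by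
  refine isBoundedUnder_of ⟨‖L‖, fun H => ?_⟩
  rw [norm_div]
  exact div_le_of_le_mul₀ (norm_nonneg _) (norm_nonneg _) (L.le_opNorm H)

theorem hasDerivAt_sub_mul_deriv_iff {u v : ℂ → ℂ} {Z : ℂ} (hu : AnalyticAt ℂ u Z)
    (L : ℂ →L[ℝ] ℂ) (d : ℂ) :
    HasDerivAt (fun W => v W - L W * deriv u W) (d - L Z * deriv (deriv u) Z) Z ↔
      Tendsto (fun H => H⁻¹ * (v (Z + H) - v Z) - H⁻¹ * (u (Z + H) - u Z) * (L H / H))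
        (𝓝[≠] 0) (𝓝 d) := by
  have h1 := hasDerivAt_iff_tendsto_slope_zero.1 hu.differentiableAt.hasDerivAt
  have h2 := hasDerivAt_iff_tendsto_slope_zero.1 hu.deriv.differentiableAt.hasDerivAt
  have h3 : Tendsto (fun H => deriv u (Z + H)) (𝓝[≠] 0) (𝓝 (deriv u Z)) := by
    have hc : ContinuousAt (fun H => deriv u (Z + H)) 0 :=
      ContinuousAt.comp (g := deriv u) (by simpa using hu.deriv.continuousAt) (by fun_prop)
    simpa using hc.tendsto.mono_left nhdsWithin_le_nhds
  have h4 := (h1.sub h3)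
  rw [sub_self] at h4
  have h5 := (h2.const_mul (L Z)).sub
    (h4.zero_mul_isBoundedUnder_le (isBoundedUnder_norm_div_self L _))
  rw [sub_zero] at h5
  rw [hasDerivAt_iff_tendsto_slope_zero]
  constructor
  · intro h
    have h6 := h.add h5
    rw [sub_add_cancel] at h6
    refine h6.congr' ?_
    filter_upwards [self_mem_nhdsWithin] with H (hH : H ≠ 0)
    simp only [smul_eq_mul, map_add]
    field_simp
    ring
  · intro h
    refine (h.sub h5).congr' ?_
    filter_upwards [self_mem_nhdsWithin] with H (hH : H ≠ 0)
    simp only [smul_eq_mul, map_add]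
    field_simp
    ring

theorem monogenicOn_graphEmb_iff {e₁ e₂ : Biharm} {L : ℂ →L[ℝ] ℂ}
    (hL : biharmPlane e₁ e₂ = Set.range (graphEmb L)) (Φ : Biharm → Biharm)
    {U : Set ℂ} (hU : IsOpen U) :
    MonogenicOn e₁ e₂ Φ (graphEmb L '' U) ↔
      ∃ F F₀ : ℂ → ℂ, (∀ Z ∈ U, DifferentiableAt ℂ F Z) ∧ (∀ Z ∈ U, DifferentiableAt ℂ F₀ Z) ∧
        ∀ Z ∈ U, Φ (graphEmb L Z) = F Z • (1 : Biharm) + (L Z * deriv F Z + F₀ Z) • ε := by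
  have analyticAt {F : ℂ → ℂ} (hF : ∀ Z ∈ U, DifferentiableAt ℂ F Z) {Z : ℂ} (hZ : Z ∈ U) :
      AnalyticAt ℂ F Z :=
    DifferentiableOn.analyticAt (fun W hW => (hF W hW).differentiableWithinAt) (hU.mem_nhds hZ)
  rw [MonogenicOn, Set.forall_mem_image]
  simp only [hasMonoDerivAt_graphEmb_iff hL]
  constructor
  · intro h
    have hu : ∀ Z ∈ U, DifferentiableAt ℂ (fun W => (Φ (graphEmb L W)).fst) Z := fun Z hZ =>
      (h hZ).choose_spec.1.differentiableAt
    refine ⟨fun W => (Φ (graphEmb L W)).fst, fun W => (Φ (graphEmb L W)).snd -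
      L W * deriv (fun W => (Φ (graphEmb L W)).fst) W, hu, fun Z hZ => ?_, fun Z _ => ?_⟩
    · obtain ⟨d, -, hd⟩ := h hZ
      exact ((hasDerivAt_sub_mul_deriv_iff (v := fun W => (Φ (graphEmb L W)).snd)
        (analyticAt hu hZ) L d.snd).2 hd).differentiableAt
    · ext <;> simp
  · rintro ⟨F, F₀, hF, hF₀, hΦ⟩ Z hZ
    have hu : (fun W => (Φ (graphEmb L W)).fst) =ᶠ[𝓝 Z] F := by
      filter_upwards [hU.mem_nhds hZ] with W hW
      simp [hΦ W hW]
    have hw : (fun W => (Φ (graphEmb L W)).snd -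
        L W * deriv (fun W => (Φ (graphEmb L W)).fst) W) =ᶠ[𝓝 Z] F₀ := by
      filter_upwards [hU.mem_nhds hZ, hu.deriv] with W hW hW'
      simp [hΦ W hW, hW']
    have ha := (analyticAt hF hZ).congr hu.symm
    refine ⟨TrivSqZeroExt.inl (deriv F Z) + TrivSqZeroExt.inr (deriv F₀ Z +
      L Z * deriv (deriv fun W => (Φ (graphEmb L W)).fst) Z), ?_, ?_⟩
    · simpa using (hF Z hZ).hasDerivAt.congr_of_eventuallyEq hu
    · refine (hasDerivAt_sub_mul_deriv_iff (v := fun W => (Φ (graphEmb L W)).snd) ha L _).1 ?_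
      simpa using (hF₀ Z hZ).hasDerivAt.congr_of_eventuallyEq hw

/-- Representation of monogenic functions by pairs of holomorphic functions: for the
biharmonic basis `e₁ = α₁·1 + β₁·ε`, `e₂ = σ·i·(α₁·1 + β₂·ε)`, a function `Φ` is
monogenic on `D_ζ` iff
`Φ(x e₁ + y e₂) = F(Z)·1 + (((β₁/α₁)Z + σ i (β₂ - β₁) y) F′(Z) + F₀(Z))·ε`,
`Z = α₁(x + σ i y)`, for some functions `F`, `F₀` holomorphic on `D_Z`. -/
theorem monogenicOn_iff_holomorphicRep (α₁ β₁ β₂ σ : ℂ) (hσ : σ = 1 ∨ σ = -1)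
    (hα : α₁ ≠ 0) (hβ : β₁ ≠ β₂) (e₁ e₂ : Biharm)
    (he₁ : e₁ = α₁ • (1 : Biharm) + β₁ • ε)
    (he₂ : e₂ = (σ * Complex.I) • (α₁ • (1 : Biharm) + β₂ • ε))
    (D : Set (ℝ × ℝ)) (hD : IsOpen D) (hDconn : IsConnected D)
    (Φ : Biharm → Biharm) :
    MonogenicOn e₁ e₂ Φ (emb e₁ e₂ '' D) ↔
      ∃ F F₀ : ℂ → ℂ,
        (∀ Z ∈ (fun p : ℝ × ℝ => α₁ * ((p.1 : ℂ) + σ * Complex.I * p.2)) '' D,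
          DifferentiableAt ℂ F Z) ∧
        (∀ Z ∈ (fun p : ℝ × ℝ => α₁ * ((p.1 : ℂ) + σ * Complex.I * p.2)) '' D,
          DifferentiableAt ℂ F₀ Z) ∧
        ∀ p ∈ D,
          Φ (emb e₁ e₂ p) =
            F (α₁ * ((p.1 : ℂ) + σ * Complex.I * p.2)) • (1 : Biharm) +
              ((β₁ / α₁ * (α₁ * ((p.1 : ℂ) + σ * Complex.I * p.2))
                    + σ * Complex.I * (β₂ - β₁) * p.2)
                  * deriv F (α₁ * ((p.1 : ℂ) + σ * Complex.I * p.2))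
                + F₀ (α₁ * ((p.1 : ℂ) + σ * Complex.I * p.2))) • ε := by
  obtain ⟨s, hs, rfl⟩ : ∃ s : ℝ, s * s = 1 ∧ σ = s := by
    rcases hσ with rfl | rfl
    exacts [⟨1, by simp⟩, ⟨-1, by simp⟩]
  have hs' : (s : ℂ) * s = 1 := mod_cast hs
  set z : ℝ × ℝ → ℂ := fun p => α₁ * ((p.1 : ℂ) + s * Complex.I * p.2) with hz
  let q : ℂ → ℝ × ℝ := fun Z => ((Z / α₁).re, s * (Z / α₁).im)
  have hqz : Function.LeftInverse q z := fun p => by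
    simp [q, hz, hα, ← mul_assoc, hs]
  have hzq : Function.RightInverse q z := fun Z => by
    have h : ((Z / α₁).re : ℂ) + s * Complex.I * ((s * (Z / α₁).im : ℝ) : ℂ) = Z / α₁ := by
      conv_rhs => rw [← Complex.re_add_im (Z / α₁)]
      push_cast
      linear_combination ((Z / α₁).im : ℂ) * Complex.I * hs'
    simp only [hz, q, h]
    field_simp
  have hq : Continuous q := by fun_prop
  let M : ℂ →L[ℝ] ℂ := α₁⁻¹ • ContinuousLinearMap.id ℝ ℂ
  let L : ℂ →L[ℝ] ℂ :=
    β₁ • (Complex.ofRealCLM ∘L Complex.reCLM ∘L M) +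
      (s * Complex.I * β₂ * s) • (Complex.ofRealCLM ∘L Complex.imCLM ∘L M)
  have hLq (Z : ℂ) : L Z = β₁ * (q Z).1 + s * Complex.I * β₂ * (q Z).2 := by
    simp [L, M, q, div_eq_inv_mul]
    ring
  have hLz (p : ℝ × ℝ) : L (z p) = β₁ * p.1 + s * Complex.I * β₂ * p.2 := by
    rw [hLq, hqz]
  have hemb (p : ℝ × ℝ) : emb e₁ e₂ p = graphEmb L (z p) := by
    ext
    · simp [emb, he₁, he₂, hz, -Complex.coe_smul]
      ring
    · simp [emb, he₁, he₂, hLz, -Complex.coe_smul]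
      ring
  have hplane : biharmPlane e₁ e₂ = Set.range (graphEmb L) := by
    ext ζ
    constructor
    · rintro ⟨x, y, rfl⟩
      exact ⟨z (x, y), (hemb (x, y)).symm⟩
    · rintro ⟨Z, rfl⟩
      refine ⟨(q Z).1, (q Z).2, ?_⟩
      rw [← hzq Z, ← hemb, hzq Z]
      rfl
  have hU : IsOpen (z '' D) := by
    rw [Set.image_eq_preimage_of_inverse hqz hzq]
    exact hD.preimage hq
  have himage : emb e₁ e₂ '' D = graphEmb L '' (z '' D) := by
    rw [Set.image_image]
    exact Set.image_congr fun p _ => hemb p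
  have hcoeff (p : ℝ × ℝ) : β₁ / α₁ * (α₁ * ((p.1 : ℂ) + s * Complex.I * p.2))
      + s * Complex.I * (β₂ - β₁) * p.2 = L (z p) := by
    rw [hLz]
    field_simp
    ring
  rw [himage, monogenicOn_graphEmb_iff hplane Φ hU]
  simp only [Set.forall_mem_image, hcoeff, hemb, hz]
end
end

section
/- Let (e₁, e₂) be a biharmonic basis of 𝔹, D ⊆ ℝ² an open connected set, and D_ζ := {x e₁ + y e₂ : (x,y) ∈ D}. If Φ : D_ζ → 𝔹 is monogenic in D_ζ, then its derivative Φ′ : D_ζ → 𝔹 is again monogenic in D_ζ; consequently Φ possesses monogenic derivatives Φ⁽ⁿ⁾ of every order n ∈ ℕ. -/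
open Complex Filter Topology DualNumber

noncomputable section

open TrivSqZeroExt

/-- The point of the graph of `ω : ℂ → ℂ`, seen inside the dual numbers, over `z`. -/
def graphPt (ω : ℂ →L[ℝ] ℂ) (z : ℂ) : Biharm := inl z + inr (ω z)

@[simp] lemma fst_graphPt (ω : ℂ →L[ℝ] ℂ) (z : ℂ) : (graphPt ω z).fst = z := by
  simp [graphPt]

@[simp] lemma snd_graphPt (ω : ℂ →L[ℝ] ℂ) (z : ℂ) : (graphPt ω z).snd = ω z := by
  simp [graphPt]

lemma graphPt_add (ω : ℂ →L[ℝ] ℂ) (z k : ℂ) :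
    graphPt ω z + graphPt ω k = graphPt ω (z + k) := by
  ext <;> simp

lemma graphPt_zero (ω : ℂ →L[ℝ] ℂ) : graphPt ω 0 = 0 := by
  ext <;> simp

lemma graphPt_injective (ω : ℂ →L[ℝ] ℂ) : Function.Injective (graphPt ω) := fun a b hab => by
  simpa using congrArg fst hab

lemma isEmbedding_graphPt (ω : ℂ →L[ℝ] ℂ) : IsEmbedding (graphPt ω) := by
  refine IsEmbedding.of_comp (f := graphPt ω) (g := fst) ?_ TrivSqZeroExt.continuous_fst ?_
  · exact (continuous_inl.add (continuous_inr.comp ω.continuous))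
  · have : fst ∘ graphPt ω = id := by ext z; simp
    rw [this]
    exact IsEmbedding.id

lemma tendsto_biharm_iff {α : Type*} {l : Filter α} {f : α → Biharm} {d : Biharm} :
    Tendsto f l (𝓝 d) ↔
      Tendsto (fun a => (f a).fst) l (𝓝 d.fst) ∧ Tendsto (fun a => (f a).snd) l (𝓝 d.snd) := by
  rw [TrivSqZeroExt.nhds_def]
  exact tendsto_prod_iff'

lemma inverse_graphPt (ω : ℂ →L[ℝ] ℂ) {k : ℂ} (hk : k ≠ 0) :
    Ring.inverse (graphPt ω k) = inl k⁻¹ - inr (ω k * k⁻¹ ^ 2) := by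
  have hmul : graphPt ω k * (inl k⁻¹ - inr (ω k * k⁻¹ ^ 2)) = 1 := by
    ext
    · simp [hk]
    · simp
      field_simp
      ring
  exact Ring.inverse_unit ⟨graphPt ω k, _, hmul, by rw [mul_comm]; exact hmul⟩

/-- A biharmonic plane is the graph of an `ℝ`-linear map from the complex part to the nilpotent
part, parametrised by `ℝ²` through a linear isomorphism with the complex part. -/
lemma IsBiharmonicBasis.exists_graph {e₁ e₂ : Biharm} (h : IsBiharmonicBasis e₁ e₂) :
    ∃ (L : (ℝ × ℝ) ≃L[ℝ] ℂ) (ω : ℂ →L[ℝ] ℂ), ∀ p, emb e₁ e₂ p = graphPt ω (L p) := by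
  obtain ⟨-, hsq, hne⟩ := h
  have hfst : e₁.fst ^ 2 + e₂.fst ^ 2 = 0 := by
    simpa using congrArg fst hsq
  have he₁ : e₁.fst ≠ 0 := by
    intro h1
    have h2 : e₂.fst = 0 := by simpa [h1] using hfst
    apply hne
    ext <;> simp [pow_two, h1, h2]
  let A (a b : ℂ) : (ℝ × ℝ) →ₗ[ℝ] ℂ :=
    (LinearMap.fst ℝ ℝ ℝ).smulRight a + (LinearMap.snd ℝ ℝ ℝ).smulRight b
  have hinj : Function.Injective (A e₁.fst e₂.fst) := by
    rw [← LinearMap.ker_eq_bot, LinearMap.ker_eq_bot']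
    rintro ⟨x, y⟩ hxy
    have hxy' : (x : ℂ) * e₁.fst + y * e₂.fst = 0 := by simpa [A] using hxy
    have hprod : ((x : ℂ) ^ 2 + (y : ℂ) ^ 2) * e₁.fst ^ 2 = 0 := by
      linear_combination (x * e₁.fst - y * e₂.fst) * hxy' + (y : ℂ) ^ 2 * hfst
    have hsum : x ^ 2 + y ^ 2 = 0 := by
      have := (mul_eq_zero.1 hprod).resolve_right (pow_ne_zero 2 he₁)
      exact_mod_cast this
    have hx : x = 0 := by nlinarith [sq_nonneg x, sq_nonneg y]
    have hy : y = 0 := by nlinarith [sq_nonneg x, sq_nonneg y]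
    simp [hx, hy]
  let L : (ℝ × ℝ) ≃L[ℝ] ℂ :=
    ((A e₁.fst e₂.fst).linearEquivOfInjective hinj
      (by simp [Complex.finrank_real_complex])).toContinuousLinearEquiv
  have hL (p : ℝ × ℝ) : L p = A e₁.fst e₂.fst p := rfl
  refine ⟨L, (A e₁.snd e₂.snd).toContinuousLinearMap ∘L (L.symm : ℂ →L[ℝ] (ℝ × ℝ)), fun p => ?_⟩
  ext
  · simp only [emb, fst_add, fst_smul, fst_graphPt, hL]
    simp [A]
  · simp only [emb, snd_add, snd_smul, snd_graphPt]
    simp [A]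

lemma nhdsWithin_biharmPlane {e₁ e₂ : Biharm} {L : (ℝ × ℝ) ≃L[ℝ] ℂ} {ω : ℂ →L[ℝ] ℂ}
    (hemb : ∀ p, emb e₁ e₂ p = graphPt ω (L p)) :
    𝓝[biharmPlane e₁ e₂ \ {0}] 0 = map (graphPt ω) (𝓝[≠] 0) := by
  have hplane : biharmPlane e₁ e₂ \ {0} = graphPt ω '' {0}ᶜ := by
    have hrange : biharmPlane e₁ e₂ = Set.range (graphPt ω) := by
      ext ζ
      constructor
      · rintro ⟨x, y, rfl⟩
        exact ⟨L (x, y), (hemb (x, y)).symm⟩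
      · rintro ⟨z, rfl⟩
        refine ⟨(L.symm z).1, (L.symm z).2, ?_⟩
        have := hemb (L.symm z)
        rw [L.apply_symm_apply] at this
        exact this.symm
    rw [hrange, Set.image_compl_eq_range_sdiff_image (graphPt_injective ω), Set.image_singleton,
      graphPt_zero]
  rw [hplane, (isEmbedding_graphPt ω).map_nhdsWithin_eq, graphPt_zero]

/-- Monogenicity in terms of components: the complex part is holomorphic, and the differential of
the nilpotent part is prescribed by the derivative. -/
lemma hasMonoDerivAt_iff {e₁ e₂ : Biharm} {L : (ℝ × ℝ) ≃L[ℝ] ℂ} {ω : ℂ →L[ℝ] ℂ}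
    (hemb : ∀ p, emb e₁ e₂ p = graphPt ω (L p)) (Φ : Biharm → Biharm) (d : Biharm) (z : ℂ) :
    HasMonoDerivAt e₁ e₂ Φ d (graphPt ω z) ↔
      HasDerivAt (fun w => (Φ (graphPt ω w)).fst) d.fst z ∧
        HasFDerivAt (fun w => (Φ (graphPt ω w)).snd)
          (d.snd • ContinuousLinearMap.id ℝ ℂ + d.fst • ω) z := by
  set f : ℂ → ℂ := fun w => (Φ (graphPt ω w)).fst with hf
  set g : ℂ → ℂ := fun w => (Φ (graphPt ω w)).snd with hg
  have hsplit : HasMonoDerivAt e₁ e₂ Φ d (graphPt ω z) ↔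
      Tendsto (fun k => k⁻¹ • (f (z + k) - f z)) (𝓝[≠] 0) (𝓝 d.fst) ∧
      Tendsto (fun k => k⁻¹ * (g (z + k) - g z) - k⁻¹ * (f (z + k) - f z) * (ω k * k⁻¹))
        (𝓝[≠] 0) (𝓝 d.snd) := by
    rw [HasMonoDerivAt, nhdsWithin_biharmPlane hemb, tendsto_map'_iff, tendsto_biharm_iff]
    refine and_congr (tendsto_congr' ?_) (tendsto_congr' ?_)
    · filter_upwards [self_mem_nhdsWithin] with k hk
      simp [inverse_graphPt ω hk, graphPt_add, hf, mul_comm]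
    · filter_upwards [self_mem_nhdsWithin] with k hk
      simp [inverse_graphPt ω hk, graphPt_add, hf, hg]
      ring
  rw [hsplit, ← hasDerivAt_iff_tendsto_slope_zero]
  refine and_congr_right fun hfd => ?_
  have hbdd : Tendsto (fun k => (k⁻¹ * (f (z + k) - f z) - d.fst) * (ω k * k⁻¹))
      (𝓝[≠] 0) (𝓝 0) := by
    refine Tendsto.zero_mul_isBoundedUnder_le ?_ ?_
    · have := (hasDerivAt_iff_tendsto_slope_zero.1 hfd).sub_const d.fst
      simpa using this
    · refine isBoundedUnder_of ⟨‖ω‖, fun k => ?_⟩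
      simp only [Function.comp_apply, norm_mul, norm_inv]
      exact mul_inv_le_of_le_mul₀ (norm_nonneg _) (norm_nonneg _) (ω.le_opNorm k)
  have hfderiv : HasFDerivAt g (d.snd • ContinuousLinearMap.id ℝ ℂ + d.fst • ω) z ↔
      Tendsto (fun k => k⁻¹ * (g (z + k) - g z) - d.snd - d.fst * (ω k * k⁻¹))
        (𝓝[≠] 0) (𝓝 0) := by
    rw [hasFDerivAt_iff_isLittleO_nhds_zero,
      Asymptotics.isLittleO_iff_tendsto' (by simp +contextual)]
    have hcont := continuousAt_iff_punctured_nhds (a := (0 : ℂ)) (f := fun k =>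
      (g (z + k) - g z - (d.snd • ContinuousLinearMap.id ℝ ℂ + d.fst • ω) k) / k)
    simp only [ContinuousAt, div_zero] at hcont
    rw [hcont]
    refine tendsto_congr' ?_
    filter_upwards [self_mem_nhdsWithin] with k hk
    have hk' : k ≠ 0 := hk
    simp
    field_simp
    ring
  rw [hfderiv, ← tendsto_sub_nhds_zero_iff]
  constructor <;> intro ht
  · simpa using (ht.add hbdd).congr fun k => by ring
  · simpa using (ht.sub hbdd).congr fun k => by ring

theorem HasMonoDerivAt.monogenicOn_deriv {e₁ e₂ : Biharm} (h : IsBiharmonicBasis e₁ e₂)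
    {D : Set (ℝ × ℝ)} (hD : IsOpen D) {Φ Φ' : Biharm → Biharm}
    (hΦ : ∀ ζ ∈ emb e₁ e₂ '' D, HasMonoDerivAt e₁ e₂ Φ (Φ' ζ) ζ) :
    MonogenicOn e₁ e₂ Φ' (emb e₁ e₂ '' D) := by
  obtain ⟨L, ω, hemb⟩ := h.exists_graph
  have hΩ : IsOpen (L '' D) := L.toHomeomorph.isOpenMap D hD
  have hmem : ∀ z ∈ L '' D, graphPt ω z ∈ emb e₁ e₂ '' D := by
    rintro _ ⟨p, hp, rfl⟩
    exact ⟨p, hp, hemb p⟩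
  have hcomp := fun z hz => (hasMonoDerivAt_iff hemb Φ _ z).1 (hΦ _ (hmem z hz))
  set F : ℂ → ℂ := fun w => (Φ (graphPt ω w)).fst
  set V : ℂ → ℂ := fun w => (Φ (graphPt ω w)).snd
  have hFd : DifferentiableOn ℂ F (L '' D) := fun z hz =>
    (hcomp z hz).1.differentiableAt.differentiableWithinAt
  have hF'd := hFd.deriv hΩ
  have hF''d := hF'd.deriv hΩ
  have hF' : ∀ z ∈ L '' D, (Φ' (graphPt ω z)).fst = deriv F z := fun z hz =>
    (hcomp z hz).1.deriv.symm
  have hmulω : ∀ (f : ℂ → ℂ) (f' z : ℂ), HasDerivAt f f' z →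
      HasFDerivAt (fun w => ω w * f w)
        ((ω z * f') • ContinuousLinearMap.id ℝ ℂ + f z • ω) z := by
    intro f f' z hf
    refine (ω.hasFDerivAt.mul (hf.hasFDerivAt.restrictScalars ℝ)).congr_fderiv ?_
    ext
    simp
    ring
  have hG : ∀ z ∈ L '' D, HasDerivAt (fun w => V w - ω w * deriv F w)
      ((Φ' (graphPt ω z)).snd - ω z * deriv (deriv F) z) z := by
    intro z hz
    have hF'z := (hF'd.differentiableAt (hΩ.mem_nhds hz)).hasDerivAt
    have := (hcomp z hz).2.sub (hmulω _ _ z hF'z)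
    rw [hasDerivAt_iff_hasFDerivAt]
    refine hasFDerivAt_of_restrictScalars ℝ this ?_
    ext
    simp [hF' z hz]
    ring
  set G : ℂ → ℂ := fun w => V w - ω w * deriv F w
  have hG'd := DifferentiableOn.deriv
    (fun z hz => (hG z hz).differentiableAt.differentiableWithinAt) hΩ
  have hV' : ∀ z ∈ L '' D,
      (Φ' (graphPt ω z)).snd = deriv G z + ω z * deriv (deriv F) z := fun z hz => by
    rw [(hG z hz).deriv]; ring
  rintro _ ⟨p, hp, rfl⟩
  have hz : L p ∈ L '' D := ⟨p, hp, rfl⟩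
  have hnhds := hΩ.mem_nhds hz
  rw [hemb]
  refine ⟨inl (deriv (deriv F) (L p)) +
    inr (deriv (deriv G) (L p) + ω (L p) * deriv (deriv (deriv F)) (L p)), ?_⟩
  rw [hasMonoDerivAt_iff hemb]
  constructor
  · have := (hF'd.differentiableAt hnhds).hasDerivAt.congr_of_eventuallyEq
      (mem_of_superset hnhds hF')
    simpa using this
  · have hG'' := (hG'd.differentiableAt hnhds).hasDerivAt.hasFDerivAt.restrictScalars ℝ
    have hF''' := hmulω _ _ _ (hF''d.differentiableAt hnhds).hasDerivAt
    refine ((hG''.add hF''').congr_of_eventuallyEq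
      (mem_of_superset hnhds hV')).congr_fderiv ?_
    ext
    simp
    ring

open Classical in
/-- The monogenic derivative of `Φ`, equal to `0` where it does not exist. -/
def monoDeriv (e₁ e₂ : Biharm) (Φ : Biharm → Biharm) (ζ : Biharm) : Biharm :=
  if h : ∃ d, HasMonoDerivAt e₁ e₂ Φ d ζ then h.choose else 0

lemma MonogenicOn.hasMonoDerivAt {e₁ e₂ : Biharm} {Φ : Biharm → Biharm} {S : Set Biharm}
    (hΦ : MonogenicOn e₁ e₂ Φ S) {ζ : Biharm} (hζ : ζ ∈ S) :
    HasMonoDerivAt e₁ e₂ Φ (monoDeriv e₁ e₂ Φ ζ) ζ := by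
  rw [monoDeriv, dif_pos (hΦ ζ hζ)]
  exact (hΦ ζ hζ).choose_spec

/-- The derivative of a monogenic function is monogenic, and consequently a monogenic
function possesses monogenic derivatives of every order. -/
theorem deriv_monogenicOn (e₁ e₂ : Biharm) (h : IsBiharmonicBasis e₁ e₂)
    (D : Set (ℝ × ℝ)) (hD : IsOpen D) (hDconn : IsConnected D)
    (Φ Φ' : Biharm → Biharm)
    (hΦ : ∀ ζ ∈ emb e₁ e₂ '' D, HasMonoDerivAt e₁ e₂ Φ (Φ' ζ) ζ) :
    MonogenicOn e₁ e₂ Φ' (emb e₁ e₂ '' D) ∧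
      ∃ Φs : ℕ → Biharm → Biharm, Φs 0 = Φ ∧
        ∀ n : ℕ, ∀ ζ ∈ emb e₁ e₂ '' D, HasMonoDerivAt e₁ e₂ (Φs n) (Φs (n + 1) ζ) ζ := by
  refine ⟨HasMonoDerivAt.monogenicOn_deriv h hD hΦ, fun n => (monoDeriv e₁ e₂)^[n] Φ, rfl, ?_⟩
  have hmono : ∀ n, MonogenicOn e₁ e₂ ((monoDeriv e₁ e₂)^[n] Φ) (emb e₁ e₂ '' D) := by
    intro n
    induction n with
    | zero => exact fun ζ hζ => ⟨_, hΦ ζ hζ⟩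
    | succ n ih =>
      rw [Function.iterate_succ_apply']
      exact HasMonoDerivAt.monogenicOn_deriv h hD fun ζ hζ => ih.hasMonoDerivAt hζ
  intro n ζ hζ
  simp only [Function.iterate_succ_apply']
  exact (hmono n).hasMonoDerivAt hζ
end
end

section
/- Let (e₁, e₂) be a biharmonic basis of 𝔹, D ⊆ ℝ² an open connected set, and D_ζ := {x e₁ + y e₂ : (x,y) ∈ D}. If Φ : D_ζ → 𝔹 is monogenic in D_ζ, then the map Φ̂ : D → 𝔹, Φ̂(x,y) := Φ(x e₁ + y e₂), is infinitely differentiable (of class C^∞) on D as a map from ℝ² into the four-dimensional real vector space 𝔹; in particular all four real components U_k[Φ], k = 1,…,4, are infinitely differentiable on D. -/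
open Complex Filter Topology DualNumber

noncomputable section

open ComplexConjugate in
/-- The generalized Cauchy-Riemann system `∂F/∂z̄ = 0`, `∂G/∂z̄ = (β / a) F'`, written with difference
quotients: its solutions are smooth. -/
lemma contDiffOn_of_tendsto_slopes {a α β : ℂ} (ha : a ≠ 0) {F G : ℂ → ℂ} {U : Set ℂ}
    (hU : IsOpen U)
    (hF : ∀ t ∈ U, ∃ d, Tendsto (fun s => (F (t + s) - F t) * (a * s)⁻¹) (𝓝[≠] 0) (𝓝 d))
    (hG : ∀ t ∈ U, ∃ d, Tendsto (fun s => (G (t + s) - G t) * (a * s)⁻¹ -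
      (F (t + s) - F t) * ((α * s + β * conj s) * ((a * s)⁻¹ * (a * s)⁻¹))) (𝓝[≠] 0) (𝓝 d)) :
    ContDiffOn ℝ (⊤ : ℕ∞) F U ∧ ContDiffOn ℝ (⊤ : ℕ∞) G U := by
  have hFd : DifferentiableOn ℂ F U := by
    intro t ht
    obtain ⟨d, hd⟩ := hF t ht
    have : HasDerivAt F (a * d) t := by
      rw [hasDerivAt_iff_tendsto_slope_zero]
      refine (hd.const_mul a).congr fun s => ?_
      rw [smul_eq_mul, mul_inv]
      field_simp
    exact this.differentiableAt.differentiableWithinAt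
  have hF'd : DifferentiableOn ℂ (deriv F) U := hFd.deriv hU
  set H : ℂ → ℂ := fun t => G t - β / a * (conj t * deriv F t) with hH
  have hHd : DifferentiableOn ℂ H U := by
    intro t ht
    obtain ⟨d, hd⟩ := hG t ht
    have hUt : U ∈ 𝓝 t := hU.mem_nhds ht
    have h1 : Tendsto (fun s => s⁻¹ • (F (t + s) - F t)) (𝓝[≠] 0) (𝓝 (deriv F t)) :=
      hasDerivAt_iff_tendsto_slope_zero.1 (hFd.differentiableAt hUt).hasDerivAt
    have h2 : Tendsto (fun s => s⁻¹ • (deriv F (t + s) - deriv F t)) (𝓝[≠] 0)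
        (𝓝 (deriv (deriv F) t)) :=
      hasDerivAt_iff_tendsto_slope_zero.1 (hF'd.differentiableAt hUt).hasDerivAt
    have h3 : Tendsto (fun s => deriv F (t + s)) (𝓝[≠] 0) (𝓝 (deriv F t)) := by
      have h : ContinuousAt (deriv F) (t + 0) := by
        simpa using (hF'd.differentiableAt hUt).continuousAt
      have h' : ContinuousAt (fun s => deriv F (t + s)) 0 :=
        ContinuousAt.comp (f := fun s => t + s) h (by fun_prop)
      simpa [ContinuousAt] using h'.tendsto.mono_left nhdsWithin_le_nhds
    have h4 : Tendsto (fun s => (conj s * s⁻¹) * (s⁻¹ • (F (t + s) - F t) - deriv F (t + s)))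
        (𝓝[≠] 0) (𝓝 0) := by
      refine isBoundedUnder_le_mul_tendsto_zero ?_ (by simpa using h1.sub h3)
      refine isBoundedUnder_of ⟨1, fun s => ?_⟩
      rcases eq_or_ne s 0 with rfl | hs
      · simp
      · simp [hs]
    have key : HasDerivAt H (a * d + α / a * deriv F t + β / a * 0
        - β / a * (conj t * deriv (deriv F) t)) t := by
      rw [hasDerivAt_iff_tendsto_slope_zero]
      refine ((((hd.const_mul a).add (h1.const_mul (α / a))).add (h4.const_mul (β / a))).sub
        ((h2.const_mul (conj t)).const_mul (β / a))).congr' ?_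
      filter_upwards [self_mem_nhdsWithin] with s hs
      have hs : s ≠ 0 := hs
      simp only [hH, smul_eq_mul, map_add]
      field_simp
      ring
    exact key.differentiableAt.differentiableWithinAt
  have smooth {f : ℂ → ℂ} (hf : DifferentiableOn ℂ f U) : ContDiffOn ℝ (⊤ : ℕ∞) f U :=
    (hf.contDiffOn hU).restrict_scalars ℝ
  refine ⟨smooth hFd, ?_⟩
  have hconj : ContDiffOn ℝ (⊤ : ℕ∞) (fun t : ℂ => conj t) U := conjCLE.contDiff.contDiffOn
  refine ((smooth hHd).add (contDiffOn_const.mul (hconj.mul (smooth hF'd)))).congr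
    (f₁ := G) (f := fun t => H t + β / a * (conj t * deriv F t)) fun t _ => ?_
  simp [hH]

lemma DualNumber.inverse_eq {x : DualNumber ℂ} (hx : x.fst ≠ 0) :
    Ring.inverse x = TrivSqZeroExt.inl x.fst⁻¹ -
      TrivSqZeroExt.inr (x.snd * (x.fst⁻¹ * x.fst⁻¹)) := by
  have hu : IsUnit x := TrivSqZeroExt.isUnit_iff_isUnit_fst.2 hx.isUnit
  rw [← mul_one (Ring.inverse x), Ring.inverse_mul_eq_iff_eq_mul _ _ _ hu]
  ext
  · simp [hx]
  · simp
    field_simp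
    ring

/-- Coordinates of a biharmonic basis: `e₂.fst = ± i e₁.fst`, and the two vectors have a nonzero
determinant. -/
lemma IsBiharmonicBasis.exists_sign {e₁ e₂ : Biharm} (h : IsBiharmonicBasis e₁ e₂) :
    ∃ σ : ℝ, σ * σ = 1 ∧ e₂.fst = σ * I * e₁.fst ∧ e₁.fst ≠ 0 ∧
      e₁.fst * e₂.snd - e₂.fst * e₁.snd ≠ 0 := by
  obtain ⟨-, h1, h2⟩ := h
  have hf : e₁.fst ^ 2 + e₂.fst ^ 2 = 0 := by
    simpa using congrArg TrivSqZeroExt.fst h1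
  have hs : e₁.fst * e₁.snd + e₂.fst * e₂.snd ≠ 0 := by
    intro h0
    apply h2
    ext
    · simpa using hf
    · simp [pow_two]
      linear_combination 2 * h0
  have hσ : ∃ σ : ℝ, σ * σ = 1 ∧ e₂.fst = σ * I * e₁.fst := by
    have : (e₂.fst - I * e₁.fst) * (e₂.fst + I * e₁.fst) = 0 := by
      linear_combination hf - e₁.fst ^ 2 * I_sq
    rcases mul_eq_zero.1 this with h | h
    · exact ⟨1, by norm_num, by push_cast; linear_combination h⟩
    · exact ⟨-1, by norm_num, by push_cast; linear_combination h⟩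
  obtain ⟨σ, hσ, he⟩ := hσ
  refine ⟨σ, hσ, he, fun h0 => hs (by simp [he, h0]), fun h0 => hs ?_⟩
  have hσ' : (σ : ℂ) * σ = 1 := by exact_mod_cast hσ
  rw [he] at h0 ⊢
  linear_combination (σ * I) * h0 + e₁.fst * e₁.snd * (σ * σ * I_sq - hσ')

/-- The `fst` and `snd` parts of a monogenic function are smooth functions of `(x, y)`. -/
lemma MonogenicOn.contDiffOn_fst_snd {e₁ e₂ : Biharm} (h : IsBiharmonicBasis e₁ e₂)
    {D : Set (ℝ × ℝ)} (hD : IsOpen D) {Φ : Biharm → Biharm}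
    (hΦ : MonogenicOn e₁ e₂ Φ (emb e₁ e₂ '' D)) :
    ContDiffOn ℝ (⊤ : ℕ∞) (fun p => (Φ (emb e₁ e₂ p)).fst) D ∧
      ContDiffOn ℝ (⊤ : ℕ∞) (fun p => (Φ (emb e₁ e₂ p)).snd) D := by
  obtain ⟨σ, hσ, he, ha, -⟩ := h.exists_sign
  have hσ' : (σ : ℂ) * σ = 1 := by exact_mod_cast hσ
  set E : ℂ → ℝ × ℝ := fun t => (t.re, σ * t.im) with hE
  set P : ℝ × ℝ → ℂ := fun p => p.1 + (σ * p.2 : ℝ) * I with hP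
  have hEP : ∀ p, E (P p) = p := fun p => by
    ext
    · simp [hE, hP]
    · simp [hE, hP, ← mul_assoc, hσ]
  have hEc : Continuous E := by fun_prop
  have hPs : ContDiff ℝ (⊤ : ℕ∞) P := by
    refine (ofRealCLM.contDiff.comp contDiff_fst).add
      ((ofRealCLM.contDiff.comp (contDiff_const.mul contDiff_snd)).mul contDiff_const)
  have hadd : ∀ t s, emb e₁ e₂ (E (t + s)) = emb e₁ e₂ (E t) + emb e₁ e₂ (E s) := fun t s => by
    simp only [emb, hE, add_re, add_im, mul_add, ofReal_add, add_smul]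
    abel
  have hfst : ∀ t, (emb e₁ e₂ (E t)).fst = e₁.fst * t := fun t => by
    simp [-coe_smul, emb, hE, he]
    linear_combination t.im * I * e₁.fst * hσ' + e₁.fst * re_add_im t
  have hsnd : ∀ t, (emb e₁ e₂ (E t)).snd = (e₁.snd - σ * I * e₂.snd) / 2 * t +
      (e₁.snd + σ * I * e₂.snd) / 2 * (starRingEnd ℂ) t := fun t => by
    have hc : (starRingEnd ℂ) t = t.re - t.im * I := by apply Complex.ext <;> simp
    simp [-coe_smul, emb, hE]
    linear_combination t.im * σ * e₂.snd * I_sq + (e₁.snd - σ * I * e₂.snd) / 2 * re_add_im t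
      - (e₁.snd + σ * I * e₂.snd) / 2 * hc
  have hlim : Tendsto (fun t => emb e₁ e₂ (E t)) (𝓝[≠] 0) (𝓝[biharmPlane e₁ e₂ \ {0}] 0) := by
    refine tendsto_nhdsWithin_iff.2 ⟨?_, ?_⟩
    · have hc : Continuous fun t => emb e₁ e₂ (E t) := by
        unfold emb
        fun_prop
      have := (hc.tendsto 0).mono_left (nhdsWithin_le_nhds (s := {0}ᶜ))
      simpa [emb, hE] using this
    · filter_upwards [self_mem_nhdsWithin] with t ht
      refine ⟨⟨_, _, rfl⟩, fun h0 => ?_⟩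
      have := hfst t
      rw [Set.mem_singleton_iff.1 h0] at this
      simp_all
  have hder : ∀ t ∈ E ⁻¹' D, ∃ d : Biharm, Tendsto (fun s => (Φ (emb e₁ e₂ (E (t + s))) -
      Φ (emb e₁ e₂ (E t))) * Ring.inverse (emb e₁ e₂ (E s))) (𝓝[≠] 0) (𝓝 d) := by
    intro t ht
    obtain ⟨d, hd⟩ := hΦ _ (Set.mem_image_of_mem _ ht)
    refine ⟨d, (hd.comp hlim).congr fun s => ?_⟩
    simp [hadd]
  have hne : ∀ s : ℂ, s ≠ 0 → (emb e₁ e₂ (E s)).fst ≠ 0 := fun s hs => by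
    rw [hfst]
    exact mul_ne_zero ha hs
  obtain ⟨h1, h2⟩ := contDiffOn_of_tendsto_slopes ha (hD.preimage hEc)
    (F := fun t => (Φ (emb e₁ e₂ (E t))).fst) (G := fun t => (Φ (emb e₁ e₂ (E t))).snd)
    (α := (e₁.snd - σ * I * e₂.snd) / 2) (β := (e₁.snd + σ * I * e₂.snd) / 2)
    (fun t ht => by
      obtain ⟨d, hd⟩ := hder t ht
      refine ⟨d.fst, ((TrivSqZeroExt.continuous_fst.tendsto d).comp hd).congr' ?_⟩
      filter_upwards [self_mem_nhdsWithin] with s hs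
      simp [DualNumber.inverse_eq (hne s hs), hfst])
    (fun t ht => by
      obtain ⟨d, hd⟩ := hder t ht
      refine ⟨d.snd, ((TrivSqZeroExt.continuous_snd.tendsto d).comp hd).congr' ?_⟩
      filter_upwards [self_mem_nhdsWithin] with s hs
      simp [DualNumber.inverse_eq (hne s hs), hfst, hsnd]
      ring)
  have hmaps : Set.MapsTo P D (E ⁻¹' D) := fun p hp => by simpa [hEP] using hp
  exact ⟨(h1.comp hPs.contDiffOn hmaps).congr fun p _ => by simp [hEP],
    (h2.comp hPs.contDiffOn hmaps).congr fun p _ => by simp [hEP]⟩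

/-- A monogenic function is of class `C^∞`: the map `Φ̂(x,y) = Φ(x e₁ + y e₂)` is
infinitely differentiable on `D`, and in particular all four of its real components
`U₁, U₂, U₃, U₄` (with respect to the real basis `{e₁, i e₁, e₂, i e₂}` of `𝔹`) are
infinitely differentiable on `D`. -/
theorem monogenicOn_contDiff (e₁ e₂ : Biharm) (h : IsBiharmonicBasis e₁ e₂)
    (D : Set (ℝ × ℝ)) (hD : IsOpen D) (hDconn : IsConnected D)
    (Φ : Biharm → Biharm) (hΦ : MonogenicOn e₁ e₂ Φ (emb e₁ e₂ '' D)) :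
    ContDiffOn ℝ (⊤ : ℕ∞) (fun p => Φ (emb e₁ e₂ p)) D ∧
      ∀ U₁ U₂ U₃ U₄ : ℝ × ℝ → ℝ,
        (∀ p ∈ D, Φ (emb e₁ e₂ p) =
            (U₁ p : ℂ) • e₁ + (U₂ p : ℂ) • (Complex.I • e₁)
              + (U₃ p : ℂ) • e₂ + (U₄ p : ℂ) • (Complex.I • e₂)) →
        ContDiffOn ℝ (⊤ : ℕ∞) U₁ D ∧ ContDiffOn ℝ (⊤ : ℕ∞) U₂ D ∧
          ContDiffOn ℝ (⊤ : ℕ∞) U₃ D ∧ ContDiffOn ℝ (⊤ : ℕ∞) U₄ D := by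
  obtain ⟨hf, hg⟩ := hΦ.contDiffOn_fst_snd h hD
  refine ⟨?_, ?_⟩
  · have hinl : ContDiff ℝ (⊤ : ℕ∞) (TrivSqZeroExt.inl : ℂ → Biharm) :=
      (TrivSqZeroExt.inlCLM ℂ ℂ).contDiff.restrict_scalars ℝ
    have hinr : ContDiff ℝ (⊤ : ℕ∞) (TrivSqZeroExt.inr : ℂ → Biharm) :=
      (TrivSqZeroExt.inrCLM ℂ ℂ).contDiff.restrict_scalars ℝ
    exact ((hinl.comp_contDiffOn hf).add (hinr.comp_contDiffOn hg)).congr fun p _ =>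
      (TrivSqZeroExt.inl_fst_add_inr_snd_eq _).symm
  · intro U₁ U₂ U₃ U₄ hU
    obtain ⟨-, -, -, -, hdet⟩ := h.exists_sign
    set δ := e₁.fst * e₂.snd - e₂.fst * e₁.snd with hδ
    have hre : ContDiff ℝ (⊤ : ℕ∞) re := reCLM.contDiff
    have him : ContDiff ℝ (⊤ : ℕ∞) im := imCLM.contDiff
    have h1 : ContDiffOn ℝ (⊤ : ℕ∞) (fun p => (U₁ p : ℂ) + U₂ p * I) D := by
      refine (((hf.mul (contDiffOn_const (c := e₂.snd))).sub
        (hg.mul (contDiffOn_const (c := e₂.fst)))).mul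
        (contDiffOn_const (c := δ⁻¹))).congr fun p hp => ?_
      rw [eq_mul_inv_iff_mul_eq₀ hdet, hU p hp, hδ]
      simp [-coe_smul]
      ring
    have h2 : ContDiffOn ℝ (⊤ : ℕ∞) (fun p => (U₃ p : ℂ) + U₄ p * I) D := by
      refine (((hg.mul (contDiffOn_const (c := e₁.fst))).sub
        (hf.mul (contDiffOn_const (c := e₁.snd)))).mul
        (contDiffOn_const (c := δ⁻¹))).congr fun p hp => ?_
      rw [eq_mul_inv_iff_mul_eq₀ hdet, hU p hp, hδ]
      simp [-coe_smul]
      ring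
    exact ⟨(hre.comp_contDiffOn h1).congr fun p _ => by simp,
      (him.comp_contDiffOn h1).congr fun p _ => by simp,
      (hre.comp_contDiffOn h2).congr fun p _ => by simp,
      (him.comp_contDiffOn h2).congr fun p _ => by simp⟩
end
end

section
/- Let (e₁, e₂) be a biharmonic basis of 𝔹, D ⊆ ℝ² an open connected set, and D_ζ := {x e₁ + y e₂ : (x,y) ∈ D}. If Φ : D_ζ → 𝔹 is monogenic in D_ζ, then each of the four real components U_k[Φ], k = 1, 2, 3, 4, is a biharmonic function in D, i.e. ∂⁴U_k/∂x⁴ + 2 ∂⁴U_k/∂x²∂y² + ∂⁴U_k/∂y⁴ = 0 everywhere on D. -/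
open Complex Filter Topology DualNumber

noncomputable section

/-- Partial derivative in the `x`-direction. -/
def pderivX (f : ℝ × ℝ → ℝ) : ℝ × ℝ → ℝ := fun p => fderiv ℝ f p (1, 0)

/-- Partial derivative in the `y`-direction. -/
def pderivY (f : ℝ × ℝ → ℝ) : ℝ × ℝ → ℝ := fun p => fderiv ℝ f p (0, 1)

/-- `f` is biharmonic on `D`: `f` is of class `C⁴` on `D` and
`∂⁴f/∂x⁴ + 2 ∂⁴f/∂x²∂y² + ∂⁴f/∂y⁴ = 0` everywhere on `D`. -/
def IsBiharmonicOn (f : ℝ × ℝ → ℝ) (D : Set (ℝ × ℝ)) : Prop :=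
  ContDiffOn ℝ 4 f D ∧ ∀ p ∈ D,
    pderivX (pderivX (pderivX (pderivX f))) p
      + 2 * pderivX (pderivX (pderivY (pderivY f))) p
      + pderivY (pderivY (pderivY (pderivY f))) p = 0

/-- `f` is, on `D`, the real part of `A (z) + x B (z)`, where `z = x + τ i y`. -/
def IsGoursatOn (τ : ℝ) (D : Set (ℝ × ℝ)) (f : ℝ × ℝ → ℝ) (A B : ℂ → ℂ) : Prop :=
  ∀ p ∈ D, f p = (A (p.1 + τ * p.2 * I) + p.1 * B (p.1 + τ * p.2 * I)).re

/-- The set of all `z = x + τ i y` with `(x, y) ∈ D`, for `τ = ±1`. -/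
def complexDomain (τ : ℝ) (D : Set (ℝ × ℝ)) : Set ℂ := {z | (z.re, τ * z.im) ∈ D}

lemma isOpen_complexDomain (τ : ℝ) {D : Set (ℝ × ℝ)} (hD : IsOpen D) :
    IsOpen (complexDomain τ D) :=
  hD.preimage (by fun_prop : Continuous fun z : ℂ => (z.re, τ * z.im))

lemma mem_complexDomain {τ : ℝ} (hτ : τ ^ 2 = 1) {D : Set (ℝ × ℝ)} {p : ℝ × ℝ} (hp : p ∈ D) :
    (p.1 + τ * p.2 * I : ℂ) ∈ complexDomain τ D := by
  have h2 : τ * (τ * p.2) = p.2 := by rw [← mul_assoc, ← sq, hτ, one_mul]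
  simpa [complexDomain, h2] using hp

/-- The real-linear map `(x, y) ↦ x + τ i y`. -/
def complexCoord (τ : ℝ) : ℝ × ℝ →L[ℝ] ℂ :=
  ofRealCLM ∘L ContinuousLinearMap.fst ℝ ℝ ℝ
    + (τ * I : ℂ) • (ofRealCLM ∘L ContinuousLinearMap.snd ℝ ℝ ℝ)

lemma complexCoord_apply (τ : ℝ) (p : ℝ × ℝ) : complexCoord τ p = p.1 + τ * p.2 * I := by
  simp [complexCoord]; ring

lemma IsGoursatOn.fderiv_apply {τ : ℝ} (hτ : τ ^ 2 = 1) {D : Set (ℝ × ℝ)} (hD : IsOpen D)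
    {f : ℝ × ℝ → ℝ} {A B : ℂ → ℂ} (hf : IsGoursatOn τ D f A B)
    (hA : DifferentiableOn ℂ A (complexDomain τ D))
    (hB : DifferentiableOn ℂ B (complexDomain τ D)) {p : ℝ × ℝ} (hp : p ∈ D) (v : ℝ × ℝ) :
    fderiv ℝ f p v = (deriv A (complexCoord τ p) * complexCoord τ v
      + (p.1 * (deriv B (complexCoord τ p) * complexCoord τ v)
        + v.1 * B (complexCoord τ p))).re := by
  have hz : complexCoord τ p ∈ complexDomain τ D := by
    rw [complexCoord_apply]; exact mem_complexDomain hτ hp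
  have hO := (isOpen_complexDomain τ hD).mem_nhds hz
  have hL := (complexCoord τ).hasFDerivAt (x := p)
  have hA' := ((hA.differentiableAt hO).hasDerivAt.hasFDerivAt.restrictScalars ℝ).comp p hL
  have hB' := ((hB.differentiableAt hO).hasDerivAt.hasFDerivAt.restrictScalars ℝ).comp p hL
  have hx := (ofRealCLM ∘L ContinuousLinearMap.fst ℝ ℝ ℝ).hasFDerivAt (x := p)
  have hre := reCLM.hasFDerivAt.comp p (hA'.add (hx.mul hB'))
  have hev : f =ᶠ[𝓝 p] reCLM ∘ (A ∘ complexCoord τ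
      + (ofRealCLM ∘L ContinuousLinearMap.fst ℝ ℝ ℝ) * B ∘ complexCoord τ) := by
    filter_upwards [hD.mem_nhds hp] with q hq
    have := hf q hq
    rw [← complexCoord_apply] at this
    exact this
  rw [(hre.congr_of_eventuallyEq hev).fderiv]
  simp
  ring

lemma IsGoursatOn.pderivX {τ : ℝ} (hτ : τ ^ 2 = 1) {D : Set (ℝ × ℝ)} (hD : IsOpen D)
    {f : ℝ × ℝ → ℝ} {A B : ℂ → ℂ} (hf : IsGoursatOn τ D f A B)
    (hA : DifferentiableOn ℂ A (complexDomain τ D))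
    (hB : DifferentiableOn ℂ B (complexDomain τ D)) :
    IsGoursatOn τ D (pderivX f) (fun z => deriv A z + B z) (deriv B) := by
  intro p hp
  rw [_root_.pderivX, hf.fderiv_apply hτ hD hA hB hp, complexCoord_apply, complexCoord_apply]
  congr 1
  push_cast
  ring

lemma IsGoursatOn.pderivY {τ : ℝ} (hτ : τ ^ 2 = 1) {D : Set (ℝ × ℝ)} (hD : IsOpen D)
    {f : ℝ × ℝ → ℝ} {A B : ℂ → ℂ} (hf : IsGoursatOn τ D f A B)
    (hA : DifferentiableOn ℂ A (complexDomain τ D))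
    (hB : DifferentiableOn ℂ B (complexDomain τ D)) :
    IsGoursatOn τ D (pderivY f) (fun z => τ * I * deriv A z) (fun z => τ * I * deriv B z) := by
  intro p hp
  rw [_root_.pderivY, hf.fderiv_apply hτ hD hA hB hp, complexCoord_apply, complexCoord_apply]
  congr 1
  push_cast
  ring

lemma IsGoursatOn.contDiffOn {τ : ℝ} (hτ : τ ^ 2 = 1) {D : Set (ℝ × ℝ)} (hD : IsOpen D)
    {f : ℝ × ℝ → ℝ} {A B : ℂ → ℂ} (hf : IsGoursatOn τ D f A B)
    (hA : DifferentiableOn ℂ A (complexDomain τ D))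
    (hB : DifferentiableOn ℂ B (complexDomain τ D)) {n : WithTop ℕ∞} : ContDiffOn ℝ n f D := by
  have hO := isOpen_complexDomain τ hD
  have hmaps : Set.MapsTo (complexCoord τ) D (complexDomain τ D) := fun p hp => by
    rw [complexCoord_apply]; exact mem_complexDomain hτ hp
  have hA' : ContDiffOn ℝ n (A ∘ complexCoord τ) D :=
    ((hA.contDiffOn hO).restrict_scalars ℝ).comp (complexCoord τ).contDiff.contDiffOn hmaps
  have hB' : ContDiffOn ℝ n (B ∘ complexCoord τ) D :=
    ((hB.contDiffOn hO).restrict_scalars ℝ).comp (complexCoord τ).contDiff.contDiffOn hmaps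
  have hx := (ofRealCLM ∘L ContinuousLinearMap.fst ℝ ℝ ℝ).contDiff.contDiffOn (s := D) (n := n)
  refine (reCLM.contDiff.comp_contDiffOn (hA'.add (hx.mul hB'))).congr fun p hp => ?_
  have := hf p hp
  rw [← complexCoord_apply] at this
  exact this

/-- The real part of `A (z) + x B (z)` with `A`, `B` holomorphic is biharmonic. -/
lemma IsGoursatOn.isBiharmonicOn {τ : ℝ} (hτ : τ ^ 2 = 1) {D : Set (ℝ × ℝ)} (hD : IsOpen D)
    {f : ℝ × ℝ → ℝ} {A B : ℂ → ℂ} (hf : IsGoursatOn τ D f A B)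
    (hA : DifferentiableOn ℂ A (complexDomain τ D))
    (hB : DifferentiableOn ℂ B (complexDomain τ D)) : IsBiharmonicOn f D := by
  refine ⟨hf.contDiffOn hτ hD hA hB, fun p hp => ?_⟩
  have hO := isOpen_complexDomain τ hD
  have hA1 := hA.deriv hO
  have hA2 := hA1.deriv hO
  have hA3 := hA2.deriv hO
  have hB1 := hB.deriv hO
  have hB2 := hB1.deriv hO
  have dsum : ∀ {g k : ℂ → ℂ}, DifferentiableOn ℂ g (complexDomain τ D) →
      DifferentiableOn ℂ k (complexDomain τ D) → ∀ z ∈ complexDomain τ D,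
      deriv (fun z => g z + k z) z = deriv g z + deriv k z := fun hg hk z hz =>
    deriv_fun_add (hg.differentiableAt (hO.mem_nhds hz)) (hk.differentiableAt (hO.mem_nhds hz))
  have dmul : ∀ (g : ℂ → ℂ), deriv (fun z => τ * I * g z) = fun z => τ * I * deriv g z :=
    fun g => funext fun z => by simp
  have hIsq : (τ * I : ℂ) * (τ * I) = -1 := by
    have : (τ : ℂ) ^ 2 = 1 := by exact_mod_cast hτ
    linear_combination (τ : ℂ) ^ 2 * I_sq - this
  have pderivX_sq : ∀ {g : ℝ × ℝ → ℝ} {P Q : ℂ → ℂ}, IsGoursatOn τ D g P Q →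
      DifferentiableOn ℂ P (complexDomain τ D) → DifferentiableOn ℂ Q (complexDomain τ D) →
      IsGoursatOn τ D (_root_.pderivX (_root_.pderivX g))
        (fun z => deriv (deriv P) z + 2 * deriv Q z) (deriv (deriv Q)) := by
    intro g P Q hg hP hQ
    have h2 := (hg.pderivX hτ hD hP hQ).pderivX hτ hD ((hP.deriv hO).add hQ) (hQ.deriv hO)
    intro q hq
    rw [h2 q hq]
    dsimp only
    rw [dsum (hP.deriv hO) hQ _ (mem_complexDomain hτ hq)]
    congr 1
    ring
  have pderivY_sq : ∀ {g : ℝ × ℝ → ℝ} {P Q : ℂ → ℂ}, IsGoursatOn τ D g P Q →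
      DifferentiableOn ℂ P (complexDomain τ D) → DifferentiableOn ℂ Q (complexDomain τ D) →
      IsGoursatOn τ D (_root_.pderivY (_root_.pderivY g))
        (fun z => -deriv (deriv P) z) (fun z => -deriv (deriv Q) z) := by
    intro g P Q hg hP hQ
    have h2 := (hg.pderivY hτ hD hP hQ).pderivY hτ hD
      ((hP.deriv hO).const_mul _) ((hQ.deriv hO).const_mul _)
    intro q hq
    rw [h2 q hq, dmul, dmul]
    simp only [← mul_assoc, hIsq]
    simp
  have hX := pderivX_sq hf hA hB
  have hY := pderivY_sq hf hA hB
  have hXX := pderivX_sq hX (hA2.add (hB1.const_mul 2)) hB2 p hp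
  have hXY := pderivX_sq hY hA2.neg hB2.neg p hp
  have hYY := pderivY_sq hY hA2.neg hB2.neg p hp
  have hz := mem_complexDomain hτ hp
  have e1 : Set.EqOn (deriv (fun z => deriv (deriv A) z + 2 * deriv B z))
      (fun z => deriv (deriv (deriv A)) z + 2 * deriv (deriv B) z) (complexDomain τ D) := by
    intro z hz
    rw [dsum hA2 (hB1.const_mul 2) z hz]
    simp
  have e2 := (e1.deriv hO hz).trans (dsum hA3 (hB2.const_mul 2) _ hz)
  simp only [deriv_const_mul_field'] at e2
  have dneg : ∀ (g : ℂ → ℂ), deriv (fun z => -g z) = fun z => -deriv g z :=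
    fun g => funext fun z => deriv.fun_neg
  simp only [dneg, neg_neg] at hXY hYY
  dsimp only at hXX
  rw [e2] at hXX
  rw [hXX, hXY, hYY]
  simp only [add_re, mul_re, neg_re, neg_im, re_ofNat, im_ofNat, ofReal_re, ofReal_im]
  ring

lemma emb_fst {e₁ e₂ : Biharm} {τ : ℝ} (hτ : τ ^ 2 = 1) (hae : e₂.fst = τ * I * e₁.fst) (k : ℂ) :
    (emb e₁ e₂ (k.re, τ * k.im)).fst = e₁.fst * k := by
  have hτ' : (τ : ℂ) ^ 2 = 1 := by exact_mod_cast hτ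
  simp only [emb, TrivSqZeroExt.fst_add, TrivSqZeroExt.fst_smul, smul_eq_mul, hae]
  conv_rhs => rw [← re_add_im k]
  push_cast
  linear_combination (e₁.fst * k.im * I) * hτ'

/-- The increments of a function with monogenic derivative `d`, read in the coordinate
`z = x + τ i y`, are `d` times the increment of the argument, up to a term `r (k) h (k)`
with `r (k) → 0`. -/
lemma HasMonoDerivAt.exists_remainder {e₁ e₂ : Biharm} {τ : ℝ} (hτ : τ ^ 2 = 1)
    (ha : e₁.fst ≠ 0) (hae : e₂.fst = τ * I * e₁.fst) {Φ : Biharm → Biharm} {d : Biharm} {z : ℂ}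
    (hd : HasMonoDerivAt e₁ e₂ Φ d (emb e₁ e₂ (z.re, τ * z.im))) :
    ∃ r : ℂ → Biharm, Tendsto r (𝓝 0) (𝓝 0) ∧ ∀ k : ℂ,
      Φ (emb e₁ e₂ ((z + k).re, τ * (z + k).im)) - Φ (emb e₁ e₂ (z.re, τ * z.im))
        - d * emb e₁ e₂ (k.re, τ * k.im) = r k * emb e₁ e₂ (k.re, τ * k.im) := by
  have hfst : ∀ k : ℂ, (emb e₁ e₂ (k.re, τ * k.im)).fst = e₁.fst * k := emb_fst hτ hae
  have hadd : ∀ k : ℂ, emb e₁ e₂ ((z + k).re, τ * (z + k).im)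
      = emb e₁ e₂ (z.re, τ * z.im) + emb e₁ e₂ (k.re, τ * k.im) := by
    intro k
    simp only [emb, add_re, add_im]
    push_cast
    module
  have hcont : Continuous fun k : ℂ => emb e₁ e₂ (k.re, τ * k.im) := by
    unfold emb
    fun_prop
  have h0 : emb e₁ e₂ ((0 : ℂ).re, τ * (0 : ℂ).im) = 0 := by simp [emb]
  have hne : ∀ k : ℂ, k ≠ 0 → emb e₁ e₂ (k.re, τ * k.im) ≠ 0 := fun k hk h => by
    have := hfst k
    rw [h] at this
    simp [ha, hk] at this
  have hlim : Tendsto (fun k : ℂ => emb e₁ e₂ (k.re, τ * k.im)) (𝓝[≠] 0)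
      (𝓝[biharmPlane e₁ e₂ \ {0}] 0) := by
    refine tendsto_nhdsWithin_iff.2 ⟨?_, ?_⟩
    · have := hcont.tendsto 0
      rw [h0] at this
      exact this.mono_left nhdsWithin_le_nhds
    · filter_upwards [self_mem_nhdsWithin] with k hk
      exact ⟨⟨_, _, rfl⟩, hne k hk⟩
  have hq := (hd.comp hlim).sub_const d
  rw [sub_self] at hq
  refine ⟨Function.update (fun k => (Φ (emb e₁ e₂ ((z + k).re, τ * (z + k).im))
    - Φ (emb e₁ e₂ (z.re, τ * z.im))) * Ring.inverse (emb e₁ e₂ (k.re, τ * k.im)) - d) 0 0,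
    ?_, fun k => ?_⟩
  · simp only [Function.comp_def, ← hadd] at hq
    simpa [ContinuousAt] using continuousAt_update_same.2 hq
  · rcases eq_or_ne k 0 with rfl | hk
    · rw [h0]; simp
    · have hu : IsUnit (emb e₁ e₂ (k.re, τ * k.im)) := by
        rw [TrivSqZeroExt.isUnit_iff_isUnit_fst, hfst]
        exact (mul_ne_zero ha hk).isUnit
      rw [Function.update_of_ne hk, sub_mul, mul_assoc, Ring.inverse_mul_cancel _ hu, mul_one]

/-- The real-linear map sending `z = x + τ i y` to the nilpotent part of `x e₁ + y e₂`. -/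
def sndCoord (e₁ e₂ : Biharm) (τ : ℝ) : ℂ →L[ℝ] ℂ :=
  e₁.snd • (ofRealCLM ∘L reCLM) + (τ * e₂.snd) • (ofRealCLM ∘L imCLM)

lemma MonogenicOn.exists_holomorphic {e₁ e₂ : Biharm} {τ : ℝ} (hτ : τ ^ 2 = 1)
    (ha : e₁.fst ≠ 0) (hae : e₂.fst = τ * I * e₁.fst) {D : Set (ℝ × ℝ)} (hD : IsOpen D)
    {Φ : Biharm → Biharm} (hΦ : MonogenicOn e₁ e₂ Φ (emb e₁ e₂ '' D)) :
    ∃ F B H : ℂ → ℂ, DifferentiableOn ℂ F (complexDomain τ D) ∧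
      DifferentiableOn ℂ B (complexDomain τ D) ∧ DifferentiableOn ℂ H (complexDomain τ D) ∧
      ∀ p ∈ D, (Φ (emb e₁ e₂ p)).fst = F (p.1 + τ * p.2 * I) ∧
        (Φ (emb e₁ e₂ p)).snd = H (p.1 + τ * p.2 * I) + p.1 * B (p.1 + τ * p.2 * I) := by
  have hO := isOpen_complexDomain τ hD
  have hfst : ∀ k : ℂ, (emb e₁ e₂ (k.re, τ * k.im)).fst = e₁.fst * k := emb_fst hτ hae
  have hsnd : ∀ k : ℂ, (emb e₁ e₂ (k.re, τ * k.im)).snd = sndCoord e₁ e₂ τ k := by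
    intro k
    simp only [emb, sndCoord, TrivSqZeroExt.snd_add, TrivSqZeroExt.snd_smul, smul_eq_mul,
      add_apply, smul_apply, ContinuousLinearMap.comp_apply, reCLM_apply,
      imCLM_apply, ofRealCLM_apply]
    push_cast
    ring
  set F : ℂ → ℂ := fun z => (Φ (emb e₁ e₂ (z.re, τ * z.im))).fst with hF
  set G : ℂ → ℂ := fun z => (Φ (emb e₁ e₂ (z.re, τ * z.im))).snd with hG
  have key : ∀ z ∈ complexDomain τ D, ∃ d : Biharm, HasDerivAt F (d.fst * e₁.fst) z ∧
      HasFDerivAt G (d.fst • sndCoord e₁ e₂ τ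
        + (d.snd * e₁.fst) • ContinuousLinearMap.id ℝ ℂ) z := by
    intro z hz
    obtain ⟨d, hd⟩ := hΦ _ ⟨_, hz, rfl⟩
    obtain ⟨r, hr, hrem⟩ := hd.exists_remainder hτ ha hae
    have hr1 : (fun k => (r k).fst) =o[𝓝 0] (fun _ => (1 : ℂ)) :=
      (Asymptotics.isLittleO_one_iff ℂ).2
        ((TrivSqZeroExt.continuous_fst.tendsto (0 : Biharm)).comp hr)
    have hr2 : (fun k => (r k).snd) =o[𝓝 0] (fun _ => (1 : ℂ)) :=
      (Asymptotics.isLittleO_one_iff ℂ).2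
        ((TrivSqZeroExt.continuous_snd.tendsto (0 : Biharm)).comp hr)
    have hO1 : (fun k : ℂ => e₁.fst * k) =O[𝓝 0] (fun k => k) :=
      Asymptotics.isBigO_const_mul_self _ _ _
    have hO2 : (fun k : ℂ => sndCoord e₁ e₂ τ k) =O[𝓝 0] (fun k => k) :=
      (sndCoord e₁ e₂ τ).isBigO_id _
    refine ⟨d, ?_, ?_⟩
    · rw [hasDerivAt_iff_isLittleO_nhds_zero]
      refine (hr1.mul_isBigO hO1).congr (fun k => ?_) (fun k => one_mul k)
      have := congrArg TrivSqZeroExt.fst (hrem k)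
      simp only [TrivSqZeroExt.fst_sub, TrivSqZeroExt.fst_mul, hfst] at this
      rw [← this, smul_eq_mul]
      ring
    · rw [hasFDerivAt_iff_isLittleO_nhds_zero]
      refine ((hr1.mul_isBigO hO2).add (hr2.mul_isBigO hO1)).congr (fun k => ?_)
        (fun k => one_mul k)
      have := congrArg TrivSqZeroExt.snd (hrem k)
      simp only [TrivSqZeroExt.snd_sub, TrivSqZeroExt.snd_mul, hfst, hsnd, smul_eq_mul,
        MulOpposite.smul_eq_mul_unop, MulOpposite.unop_op] at this
      simp only [add_apply, smul_apply, smul_eq_mul, ContinuousLinearMap.id_apply]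
      linear_combination -this
  have hFd : DifferentiableOn ℂ F (complexDomain τ D) := fun z hz =>
    let ⟨_, h, _⟩ := key z hz
    h.differentiableAt.differentiableWithinAt
  have hF1 := hFd.deriv hO
  set c : ℂ := (e₁.snd + I * τ * e₂.snd) / e₁.fst with hc
  refine ⟨F, fun z => c * deriv F z, fun z => G z - z.re * (c * deriv F z), hFd,
    hF1.const_mul c, fun z hz => ?_, fun p hp => ?_⟩
  · obtain ⟨d, h1, h2⟩ := key z hz
    have h3 := ((hF1.differentiableAt (hO.mem_nhds hz)).const_mul
      c).hasDerivAt.hasFDerivAt.restrictScalars ℝ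
    have h4 := h2.sub ((ofRealCLM ∘L reCLM).hasFDerivAt.mul h3)
    refine DifferentiableAt.differentiableWithinAt (HasFDerivAt.differentiableAt
      (f' := ContinuousLinearMap.toSpanSingleton ℂ (d.snd * e₁.fst - I * τ * d.fst * e₂.snd
        - z.re * deriv (fun z => c * deriv F z) z))
      (hasFDerivAt_of_restrictScalars ℝ h4 ?_))
    ext k
    have hcF : c * deriv F z = d.fst * (e₁.snd + I * τ * e₂.snd) := by
      rw [h1.deriv, hc]
      field_simp
    have hk := re_add_im k
    simp [sndCoord, - deriv_const_mul_field']
    rw [hcF]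
    linear_combination (I * τ * d.fst * e₂.snd) * hk - (τ * d.fst * e₂.snd * k.im) * I_sq
  · have h2 : τ * (τ * p.2) = p.2 := by rw [← mul_assoc, ← sq, hτ, one_mul]
    simp [hF, hG, h2]

/-- Each of the four real components of a monogenic function is a biharmonic
function in `D`. -/
theorem monogenicOn_components_biharmonic (e₁ e₂ : Biharm) (h : IsBiharmonicBasis e₁ e₂)
    (D : Set (ℝ × ℝ)) (hD : IsOpen D) (hDconn : IsConnected D)
    (Φ : Biharm → Biharm) (hΦ : MonogenicOn e₁ e₂ Φ (emb e₁ e₂ '' D))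
    (U₁ U₂ U₃ U₄ : ℝ × ℝ → ℝ)
    (hdec : ∀ p ∈ D, Φ (emb e₁ e₂ p) =
        (U₁ p : ℂ) • e₁ + (U₂ p : ℂ) • (Complex.I • e₁)
          + (U₃ p : ℂ) • e₂ + (U₄ p : ℂ) • (Complex.I • e₂)) :
    IsBiharmonicOn U₁ D ∧ IsBiharmonicOn U₂ D ∧ IsBiharmonicOn U₃ D ∧ IsBiharmonicOn U₄ D := by
  obtain ⟨-, hsq, hne⟩ := h
  have hfst : (e₂.fst - I * e₁.fst) * (e₂.fst + I * e₁.fst) = 0 := by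
    have h1 : (e₁.fst ^ 2 + e₂.fst ^ 2) ^ 2 = 0 := by
      simpa using congrArg TrivSqZeroExt.fst hsq
    have h2 := pow_eq_zero_iff two_ne_zero |>.1 h1
    linear_combination h2 - e₁.fst ^ 2 * I_sq
  obtain ⟨τ, hτ, hae⟩ : ∃ τ : ℝ, τ ^ 2 = 1 ∧ e₂.fst = τ * I * e₁.fst := by
    rcases mul_eq_zero.1 hfst with h | h
    · exact ⟨1, by norm_num, by push_cast; linear_combination h⟩
    · exact ⟨-1, by norm_num, by push_cast; linear_combination h⟩
  have hτ' : (τ : ℂ) ^ 2 = 1 := by exact_mod_cast hτ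
  have hΔ : e₁.fst * e₂.snd - e₂.fst * e₁.snd ≠ 0 := by
    intro h0
    refine hne (TrivSqZeroExt.ext ?_ ?_)
    · simp only [TrivSqZeroExt.fst_add, TrivSqZeroExt.fst_pow, TrivSqZeroExt.fst_zero, hae]
      linear_combination e₁.fst ^ 2 * I ^ 2 * hτ' + e₁.fst ^ 2 * I_sq
    · simp only [sq, TrivSqZeroExt.snd_add, TrivSqZeroExt.snd_mul, TrivSqZeroExt.snd_zero, hae,
        smul_eq_mul, MulOpposite.smul_eq_mul_unop, MulOpposite.unop_op]
      rw [hae] at h0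
      linear_combination 2 * τ * I * h0 + 2 * e₁.fst * e₁.snd * (I ^ 2 * hτ' + I_sq)
  have ha : e₁.fst ≠ 0 := fun h0 => hΔ (by simp [hae, h0])
  obtain ⟨F, B, H, hF, hB, hH, hrep⟩ := hΦ.exists_holomorphic hτ ha hae hD
  have main : ∀ (l m : ℂ) (U : ℝ × ℝ → ℝ), (∀ p ∈ D,
      U p = (l * (Φ (emb e₁ e₂ p)).fst + m * (Φ (emb e₁ e₂ p)).snd).re) →
      IsBiharmonicOn U D := by
    intro l m U hU
    refine IsGoursatOn.isBiharmonicOn (A := fun z => l * F z + m * H z) (B := fun z => m * B z)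
      hτ hD (fun p hp => ?_) ((hF.const_mul l).add (hH.const_mul m)) (hB.const_mul m)
    rw [hU p hp, (hrep p hp).1, (hrep p hp).2]
    congr 1
    ring
  set Δ := e₁.fst * e₂.snd - e₂.fst * e₁.snd with hΔdef
  have hV : ∀ p ∈ D, (U₁ p + U₂ p * I : ℂ)
      = e₂.snd / Δ * (Φ (emb e₁ e₂ p)).fst + -e₂.fst / Δ * (Φ (emb e₁ e₂ p)).snd := by
    intro p hp
    rw [hdec p hp]
    simp only [TrivSqZeroExt.fst_add, TrivSqZeroExt.fst_smul, TrivSqZeroExt.snd_add,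
      TrivSqZeroExt.snd_smul, smul_eq_mul]
    field_simp
    rw [hΔdef]
    ring
  have hW : ∀ p ∈ D, (U₃ p + U₄ p * I : ℂ)
      = -e₁.snd / Δ * (Φ (emb e₁ e₂ p)).fst + e₁.fst / Δ * (Φ (emb e₁ e₂ p)).snd := by
    intro p hp
    rw [hdec p hp]
    simp only [TrivSqZeroExt.fst_add, TrivSqZeroExt.fst_smul, TrivSqZeroExt.snd_add,
      TrivSqZeroExt.snd_smul, smul_eq_mul]
    field_simp
    rw [hΔdef]
    ring
  refine ⟨main (e₂.snd / Δ) (-e₂.fst / Δ) U₁ fun p hp => ?_,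
    main (-I * (e₂.snd / Δ)) (-I * (-e₂.fst / Δ)) U₂ fun p hp => ?_,
    main (-e₁.snd / Δ) (e₁.fst / Δ) U₃ fun p hp => ?_,
    main (-I * (-e₁.snd / Δ)) (-I * (e₁.fst / Δ)) U₄ fun p hp => ?_⟩
  · rw [← hV p hp]; simp
  · rw [mul_assoc, mul_assoc, ← mul_add, ← hV p hp]; simp
  · rw [← hW p hp]; simp
  · rw [mul_assoc, mul_assoc, ← mul_add, ← hW p hp]; simp
end
end

section
/- The elements e₁ = 1 + ε and e₂ = i·(1 + 2ε) of 𝔹 form a biharmonic basis: e₁ and e₂ are linearly independent over ℂ, (e₁² + e₂²)² = 0, and e₁² + e₂² ≠ 0. -/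
open Complex Filter Topology DualNumber

noncomputable section

theorem biharm_sq_add_sq :
    ((1 : Biharm) + ε) ^ 2 + (Complex.I • ((1 : Biharm) + (2 : ℂ) • ε)) ^ 2 = (-2 : ℂ) • ε := by
  ext
  · simp [pow_two, TrivSqZeroExt.fst_mul]
  · simp only [pow_two, TrivSqZeroExt.snd_add, TrivSqZeroExt.snd_mul, TrivSqZeroExt.fst_add,
      TrivSqZeroExt.fst_one, TrivSqZeroExt.snd_one, TrivSqZeroExt.fst_smul,
      TrivSqZeroExt.snd_smul, DualNumber.fst_eps, DualNumber.snd_eps, smul_eq_mul,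
      MulOpposite.smul_eq_mul_unop, MulOpposite.unop_op]
    linear_combination 4 * Complex.I_mul_I

/-- The pair `e₁ = 1 + ε`, `e₂ = i (1 + 2 ε)` is a biharmonic basis of `𝔹`:
linearly independent over `ℂ`, `(e₁² + e₂²)² = 0` and `e₁² + e₂² ≠ 0`. -/
theorem isBiharmonicBasis_special :
    IsBiharmonicBasis (1 + ε) (Complex.I • (1 + (2 : ℂ) • ε)) := by
  refine ⟨?_, ?_, ?_⟩
  · rw [LinearIndependent.pair_iff]
    intro s t h
    have h1 := congrArg TrivSqZeroExt.fst h
    have h2 := congrArg TrivSqZeroExt.snd h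
    simp at h1 h2
    have ht : t * Complex.I = 0 := by linear_combination h2 - h1
    have ht0 : t = 0 := by simpa using ht
    exact ⟨by simpa [ht0] using h1, ht0⟩
  · rw [biharm_sq_add_sq, smul_pow, pow_two ε, DualNumber.eps_mul_eps, smul_zero]
  · rw [biharm_sq_add_sq]
    intro h
    simpa using congrArg TrivSqZeroExt.snd h
end
end

section
/- Fix the biharmonic basis e₁ = 1 + ε, e₂ = i(1 + 2ε) of 𝔹. Let D ⊆ ℝ² be an open set, D_z := {x + iy : (x,y) ∈ D}, and let f₁, f₂ be holomorphic on D_z. Define F := 2f₂ and F₀(z) := 4f₂(z) − f₁(z) − 3z f₂′(z), and let Φ := Φ[F, F₀], i.e. Φ(x e₁ + y e₂) = F(z)·1 + ((z + iy)F′(z) + F₀(z))·ε with z = x + iy. Then the first real component of Φ satisfies U₁[Φ](x,y) = Re( f₁(z) + z̄·f₂′(z) ) for all (x,y) ∈ D, where z̄ = x − iy. -/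
open Complex Filter Topology DualNumber

noncomputable section

/-- The distinguished biharmonic basis element `e₁ = 1 + ε`. -/
def e₁B : Biharm := 1 + ε

/-- The distinguished biharmonic basis element `e₂ = i (1 + 2 ε)`. -/
def e₂B : Biharm := Complex.I • (1 + (2 : ℂ) • ε)

/-- The set `D_z = {x + i y : (x, y) ∈ D} ⊆ ℂ`. -/
def Dz (D : Set (ℝ × ℝ)) : Set ℂ := (fun p : ℝ × ℝ => (p.1 : ℂ) + p.2 * Complex.I) '' D

/-- The monogenic function `Φ[F, F₀]` associated with the pair `(F, F₀)` for the
basis `e₁ = 1 + ε`, `e₂ = i (1 + 2 ε)`: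
`Φ[F, F₀](x e₁ + y e₂) = F(z)·1 + ((z + i y) F′(z) + F₀(z))·ε`, `z = x + i y`. -/
def PhiRep (F F₀ : ℂ → ℂ) (p : ℝ × ℝ) : Biharm :=
  F ((p.1 : ℂ) + p.2 * Complex.I) • (1 : Biharm)
    + ((((p.1 : ℂ) + p.2 * Complex.I) + Complex.I * p.2)
          * deriv F ((p.1 : ℂ) + p.2 * Complex.I)
        + F₀ ((p.1 : ℂ) + p.2 * Complex.I)) • ε

/-- The decomposition of an element of `𝔹` along the real basis `e₁, i e₁, e₂, i e₂`. -/
theorem smul_one_add_smul_eps_eq (a b : ℂ) :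
    a • (1 : Biharm) + b • ε =
      ((2 * a - b).re : ℂ) • e₁B + ((2 * a - b).im : ℂ) • (Complex.I • e₁B)
        + ((b - a).im : ℂ) • e₂B + ((a - b).re : ℂ) • (Complex.I • e₂B) := by
  ext <;> apply Complex.ext <;> simp [e₁B, e₂B] <;> ring

/-- For holomorphic `f₁, f₂` on `D_z`, the monogenic function `Φ = Φ[2f₂, 4f₂ - f₁ - 3zf₂′]`
has first real component `U₁[Φ](x,y) = Re(f₁(z) + z̄ f₂′(z))`, `z = x + i y`. -/
theorem firstComponent_of_rep (D : Set (ℝ × ℝ)) (hD : IsOpen D) (f₁ f₂ : ℂ → ℂ)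
    (hf₁ : ∀ z ∈ Dz D, DifferentiableAt ℂ f₁ z)
    (hf₂ : ∀ z ∈ Dz D, DifferentiableAt ℂ f₂ z)
    (Φ : Biharm → Biharm)
    (hΦ : ∀ p ∈ D, Φ (emb e₁B e₂B p) =
        PhiRep (fun w => 2 * f₂ w) (fun w => 4 * f₂ w - f₁ w - 3 * w * deriv f₂ w) p) :
    ∃ U₂ U₃ U₄ : ℝ × ℝ → ℝ, ∀ p ∈ D,
      Φ (emb e₁B e₂B p) =
        (((f₁ ((p.1 : ℂ) + p.2 * Complex.I)
            + (starRingEnd ℂ) ((p.1 : ℂ) + p.2 * Complex.I)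
                * deriv f₂ ((p.1 : ℂ) + p.2 * Complex.I)).re : ℂ)) • e₁B
          + (U₂ p : ℂ) • (Complex.I • e₁B) + (U₃ p : ℂ) • e₂B
          + (U₄ p : ℂ) • (Complex.I • e₂B) := by
  let a : ℝ × ℝ → ℂ := fun p => 2 * f₂ (p.1 + p.2 * Complex.I)
  let b : ℝ × ℝ → ℂ := fun p =>
    ((p.1 + p.2 * Complex.I) + Complex.I * p.2) * (2 * deriv f₂ (p.1 + p.2 * Complex.I))
      + (4 * f₂ (p.1 + p.2 * Complex.I) - f₁ (p.1 + p.2 * Complex.I)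
        - 3 * (p.1 + p.2 * Complex.I) * deriv f₂ (p.1 + p.2 * Complex.I))
  refine ⟨fun p => (2 * a p - b p).im, fun p => (b p - a p).im, fun p => (a p - b p).re,
    fun p hp => ?_⟩
  have hPhi : Φ (emb e₁B e₂B p) = a p • (1 : Biharm) + b p • ε := by
    rw [hΦ p hp, PhiRep, deriv_const_mul_field]
  have hfirst : f₁ (p.1 + p.2 * Complex.I) + (starRingEnd ℂ) (p.1 + p.2 * Complex.I)
      * deriv f₂ (p.1 + p.2 * Complex.I) = 2 * a p - b p := by
    simp only [a, b, map_add, map_mul, Complex.conj_ofReal, Complex.conj_I]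
    ring
  rw [hPhi, hfirst]
  exact smul_one_add_smul_eps_eq (a p) (b p)
end
end

section
/- Fix the biharmonic basis e₁ = 1 + ε, e₂ = i(1 + 2ε) of 𝔹. Let D ⊆ ℝ² be a bounded, open, connected and simply connected set and D_ζ := {x e₁ + y e₂ : (x,y) ∈ D}. For every function U₁ : D → ℝ biharmonic in D there exists a function Φ : D_ζ → 𝔹 monogenic in D_ζ whose first real component coincides with U₁, i.e. U₁[Φ](x,y) = U₁(x,y) for all (x,y) ∈ D. -/
open Complex Filter Topology DualNumber

noncomputable section

/-- On a simply connected space, local functions with locally constant differences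
glue, up to locally constant corrections. -/
theorem exists_glue_of_locally_const_sub {X A : Type*} [TopologicalSpace X]
    [SimplyConnectedSpace X] [LocallyPathConnectedSpace X] [AddCommGroup A]
    (U : X → Set X) (hU : ∀ i, IsOpen (U i)) (hmem : ∀ i, i ∈ U i) (g : X → X → A)
    (hg : ∀ i j, ∀ x ∈ U i ∩ U j, ∀ᶠ y in 𝓝 x, g i y - g j y = g i x - g j x) :
    ∃ G : X → A, ∀ x, ∀ᶠ y in 𝓝 x, G y - g x y = G x - g x x := by
  let _ : TopologicalSpace A := ⊥
  have : DiscreteTopology A := ⟨rfl⟩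
  let Z : FiberBundleCore X X A :=
    { baseSet := U
      isOpen_baseSet := hU
      indexAt := id
      mem_baseSet_at := hmem
      coordChange := fun i j x v ↦ v + (g i x - g j x)
      coordChange_self := fun i x _ v ↦ by simp
      continuousOn_coordChange := fun i j ↦ by
        rintro ⟨x, v⟩ ⟨hx, -⟩
        refine ContinuousAt.continuousWithinAt ?_
        refine (continuousAt_const (y := v + (g i x - g j x))).congr ?_
        rw [nhds_prod_eq, nhds_discrete A]
        filter_upwards [prod_mem_prod (hg i j x hx) (mem_pure.2 (Set.mem_singleton v))]
        rintro ⟨y, w⟩ ⟨hy, hw⟩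
        simp only [Set.mem_singleton_iff] at hw
        simp only [Set.mem_ofPred_eq] at hy
        simp only [hw, hy]
      coordChange_comp := fun i j k x _ v ↦ by abel }
  have hcov : IsCoveringMap Z.proj :=
    IsCoveringMap.mk Z.proj (fun _ ↦ A) (fun x ↦ Z.localTriv x) hmem
  obtain ⟨x₀⟩ : Nonempty X := inferInstance
  obtain ⟨s, ⟨-, hs⟩, -⟩ := hcov.existsUnique_continuousMap_lifts (ContinuousMap.id X) x₀
    (⟨x₀, (0 : A)⟩ : Z.TotalSpace) rfl
  have hs' : ∀ y, (s y).1 = y := fun y ↦ congrFun hs y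
  let c : X → A := fun x ↦ (Z.localTriv x (s x)).2
  have key : ∀ x y, (Z.localTriv x (s y)).2 = c y + (g y y - g x y) := by
    intro x y
    simp only [c, Z.localTriv_apply]
    change (id (s y).2 : A) + (g (s y).1 (s y).1 - g x (s y).1)
      = (id (s y).2 : A) + (g (s y).1 (s y).1 - g y (s y).1) + (g y y - g x y)
    rw [hs' y]
    abel
  refine ⟨fun y ↦ c y + g y y, fun x ↦ ?_⟩
  have hcont : ContinuousAt (fun y ↦ (Z.localTriv x (s y)).2) x := by
    refine continuous_snd.continuousAt.comp ?_
    refine ContinuousAt.comp (g := Z.localTriv x) ?_ s.continuous.continuousAt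
    refine (Z.localTriv x).continuousAt ?_
    rw [Z.mem_localTriv_source, hs' x]
    exact hmem x
  have := hcont.eventually (p := fun v ↦ v = (Z.localTriv x (s x)).2) (by
    rw [nhds_discrete]; exact eventually_pure.2 rfl)
  filter_upwards [this] with y hy
  rw [key, key] at hy
  rw [add_sub_assoc, add_sub_assoc, hy]

/-- A holomorphic function on a simply connected open set has a primitive. -/
theorem DifferentiableOn.isExactOn_of_isSimplyConnected {Ω : Set ℂ} (hΩ : IsOpen Ω)
    (hsc : IsSimplyConnected Ω) {f : ℂ → ℂ} (hf : DifferentiableOn ℂ f Ω) :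
    IsExactOn f Ω := by
  have := hsc.simplyConnectedSpace
  have := hΩ.locallyPathConnectedSpace
  choose r hr hrΩ using fun x : Ω ↦ Metric.isOpen_iff.1 hΩ x x.2
  choose F hF using fun x : Ω ↦ (hf.mono (hrΩ x)).isExactOn_ball
  obtain ⟨G, hG⟩ := exists_glue_of_locally_const_sub
    (fun i : Ω ↦ Subtype.val ⁻¹' Metric.ball (i : ℂ) (r i))
    (fun i ↦ Metric.isOpen_ball.preimage continuous_subtype_val)
    (fun i ↦ Metric.mem_ball_self (hr i)) (fun i y ↦ F i y) (by
      rintro i j x ⟨hxi, hxj⟩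
      have hopen : IsOpen (Metric.ball (i : ℂ) (r i) ∩ Metric.ball (j : ℂ) (r j)) :=
        Metric.isOpen_ball.inter Metric.isOpen_ball
      have hconn := ((convex_ball (i : ℂ) (r i)).inter
        (convex_ball (j : ℂ) (r j))).isPreconnected
      filter_upwards [(hopen.preimage continuous_subtype_val).mem_nhds
        (show x ∈ Subtype.val ⁻¹' _ from ⟨hxi, hxj⟩)] with y hy
      have hd : ∀ z ∈ Metric.ball (i : ℂ) (r i) ∩ Metric.ball (j : ℂ) (r j),
          HasDerivAt (fun w ↦ F i w - F j w) 0 z := fun z hz ↦ by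
        simpa using (hF i z hz.1).fun_sub (hF j z hz.2)
      exact hopen.is_const_of_deriv_eq_zero hconn
        (fun z hz ↦ (hd z hz).differentiableAt.differentiableWithinAt)
        (fun z hz ↦ (hd z hz).deriv) hy ⟨hxi, hxj⟩)
  classical
  refine ⟨fun z ↦ if h : z ∈ Ω then G ⟨z, h⟩ else 0, fun z hz ↦ ?_⟩
  have hFz := (hF ⟨z, hz⟩ z (Metric.mem_ball_self (hr _))).add_const
    (G ⟨z, hz⟩ - F ⟨z, hz⟩ z)
  refine hFz.congr_of_eventuallyEq ?_
  have h := hG ⟨z, hz⟩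
  rw [nhds_subtype_eq_comap, eventually_comap] at h
  filter_upwards [h, hΩ.mem_nhds hz] with w hw hwΩ
  have := hw ⟨w, hwΩ⟩ rfl
  simp only [hwΩ, dif_pos]
  rw [← this]
  simp

open InnerProductSpace in
/-- A harmonic function on a simply connected open set is the real part of a holomorphic
function. -/
theorem InnerProductSpace.HarmonicOnNhd.exists_differentiableOn_re_eq {Ω : Set ℂ} (hΩ : IsOpen Ω)
    (hsc : IsSimplyConnected Ω) {u : ℂ → ℝ} (hu : HarmonicOnNhd u Ω) :
    ∃ G : ℂ → ℂ, DifferentiableOn ℂ G Ω ∧ ∀ z ∈ Ω, (G z).re = u z := by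
  have hg : DifferentiableOn ℂ (fun z ↦ (fderiv ℝ u z 1 : ℂ) - I * fderiv ℝ u z I) Ω :=
    fun x hx ↦ (HarmonicAt.differentiableAt_complex_partial (hu x hx)).differentiableWithinAt
  obtain ⟨x₀, hx₀⟩ := hsc.nonempty
  obtain ⟨G, hG₀, hG⟩ :=
    (hg.isExactOn_of_isSimplyConnected hΩ hsc).with_val_at x₀ (u x₀)
  have hd : ∀ z ∈ Ω, HasFDerivAt (𝕜 := ℝ) (fun z ↦ (G z).re - u z) 0 z := by
    intro z hz
    have h1 := ((hG z hz).hasFDerivAt.restrictScalars ℝ)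
    have h2 := ((hu z hz).1.differentiableAt two_ne_zero).hasFDerivAt
    refine ((reCLM.hasFDerivAt.comp z h1).sub h2).congr_fderiv ?_
    ext a
    have : fderiv ℝ u z a = a.re * fderiv ℝ u z 1 + a.im * fderiv ℝ u z I := by
      conv_lhs => rw [show a = a.re • (1 : ℂ) + a.im • I by simp]
      rw [map_add, map_smul, map_smul, smul_eq_mul, smul_eq_mul]
    simp [this]
  refine ⟨G, fun z hz ↦ (hG z hz).differentiableAt.differentiableWithinAt, fun z hz ↦ ?_⟩
  have := hΩ.is_const_of_fderiv_eq_zero hsc.isPathConnected.isConnected.isPreconnected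
    (fun z hz ↦ (hd z hz).differentiableAt.differentiableWithinAt)
    (fun z hz ↦ (hd z hz).fderiv) hz hx₀
  simpa [hG₀, sub_eq_zero] using this

/-- The partial derivatives of `f : ℝ × ℝ → ℝ` are those of `f` read on `ℂ`. -/
theorem fderiv_comp_equivRealProdCLM (f : ℝ × ℝ → ℝ) :
    (fun z ↦ fderiv ℝ (f ∘ equivRealProdCLM) z 1) = pderivX f ∘ equivRealProdCLM ∧
      (fun z ↦ fderiv ℝ (f ∘ equivRealProdCLM) z I) = pderivY f ∘ equivRealProdCLM := by
  constructor <;> funext z <;>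
    simp [pderivX, pderivY, ContinuousLinearEquiv.comp_right_fderiv]

theorem ContDiffAt.laplacian_eq_fderiv_fderiv {f : ℂ → ℝ} {z : ℂ} (hf : ContDiffAt ℝ 2 f z) :
    Laplacian.laplacian f z = fderiv ℝ (fun w ↦ fderiv ℝ f w 1) z 1
      + fderiv ℝ (fun w ↦ fderiv ℝ f w I) z I := by
  have hd : DifferentiableAt ℝ (fderiv ℝ f) z :=
    (hf.fderiv_right (m := 1) (by norm_num)).differentiableAt (by norm_num)
  rw [InnerProductSpace.laplacian_eq_iteratedFDeriv_complexPlane]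
  simp only [iteratedFDeriv_two_apply]
  rw [fderiv_clm_apply hd (by fun_prop), fderiv_clm_apply hd (by fun_prop)]
  simp

theorem ContDiffAt.laplacian_comp_equivRealProdCLM {f : ℝ × ℝ → ℝ} {z : ℂ}
    (hf : ContDiffAt ℝ 2 f (equivRealProdCLM z)) :
    Laplacian.laplacian (f ∘ equivRealProdCLM) z =
      pderivX (pderivX f) (equivRealProdCLM z) + pderivY (pderivY f) (equivRealProdCLM z) := by
  rw [ContDiffAt.laplacian_eq_fderiv_fderiv
    (hf.comp z equivRealProdCLM.contDiff.contDiffAt), (fderiv_comp_equivRealProdCLM f).1,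
    (fderiv_comp_equivRealProdCLM f).2]
  exact congrArg₂ (· + ·) (congrFun (fderiv_comp_equivRealProdCLM (pderivX f)).1 z)
    (congrFun (fderiv_comp_equivRealProdCLM (pderivY f)).2 z)

theorem ContDiffOn.pderivX {f : ℝ × ℝ → ℝ} {D : Set (ℝ × ℝ)} {m n : WithTop ℕ∞}
    (hD : IsOpen D) (hf : ContDiffOn ℝ n f D) (hmn : m + 1 ≤ n) : ContDiffOn ℝ m (pderivX f) D :=
  (hf.fderiv_of_isOpen hD hmn).clm_apply contDiffOn_const

theorem ContDiffOn.pderivY {f : ℝ × ℝ → ℝ} {D : Set (ℝ × ℝ)} {m n : WithTop ℕ∞}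
    (hD : IsOpen D) (hf : ContDiffOn ℝ n f D) (hmn : m + 1 ≤ n) : ContDiffOn ℝ m (pderivY f) D :=
  (hf.fderiv_of_isOpen hD hmn).clm_apply contDiffOn_const

theorem Set.EqOn.pderivX {f g : ℝ × ℝ → ℝ} {D : Set (ℝ × ℝ)} (hD : IsOpen D)
    (h : Set.EqOn f g D) : Set.EqOn (pderivX f) (pderivX g) D := fun _ hp ↦
  congrArg (fun L : ℝ × ℝ →L[ℝ] ℝ ↦ L (1, 0)) (h.eventuallyEq_of_mem (hD.mem_nhds hp)).fderiv_eq

theorem Set.EqOn.pderivY {f g : ℝ × ℝ → ℝ} {D : Set (ℝ × ℝ)} (hD : IsOpen D)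
    (h : Set.EqOn f g D) : Set.EqOn (pderivY f) (pderivY g) D := fun _ hp ↦
  congrArg (fun L : ℝ × ℝ →L[ℝ] ℝ ↦ L (0, 1)) (h.eventuallyEq_of_mem (hD.mem_nhds hp)).fderiv_eq

theorem pderivY_pderivX_eqOn {f : ℝ × ℝ → ℝ} {D : Set (ℝ × ℝ)} (hD : IsOpen D)
    (hf : ContDiffOn ℝ 2 f D) : Set.EqOn (pderivY (pderivX f)) (pderivX (pderivY f)) D := by
  intro p hp
  have hp' := hf.contDiffAt (hD.mem_nhds hp)
  have hd : DifferentiableAt ℝ (fderiv ℝ f) p :=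
    (hp'.fderiv_right (m := 1) (by norm_num)).differentiableAt (by norm_num)
  have hs := hp'.isSymmSndFDerivAt (by simp)
  unfold pderivX pderivY
  rw [fderiv_clm_apply hd (by fun_prop), fderiv_clm_apply hd (by fun_prop)]
  simpa using hs (0, 1) (1, 0)

theorem pderivY_pderivY_pderivX_pderivX_eqOn {f : ℝ × ℝ → ℝ} {D : Set (ℝ × ℝ)} (hD : IsOpen D)
    (hf : ContDiffOn ℝ 4 f D) :
    Set.EqOn (pderivY (pderivY (pderivX (pderivX f))))
      (pderivX (pderivX (pderivY (pderivY f)))) D := by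
  have hX : ContDiffOn ℝ 3 (pderivX f) D := hf.pderivX hD (by norm_num)
  have hY : ContDiffOn ℝ 3 (pderivY f) D := hf.pderivY hD (by norm_num)
  have hXY : ContDiffOn ℝ 2 (pderivX (pderivY f)) D := hY.pderivX hD (by norm_num)
  have h1 : Set.EqOn (pderivY (pderivX (pderivX f))) (pderivX (pderivX (pderivY f))) D :=
    (pderivY_pderivX_eqOn hD (hX.of_le (by norm_num))).trans
      ((pderivY_pderivX_eqOn hD (hf.of_le (by norm_num))).pderivX hD)
  exact ((h1.pderivY hD).trans (pderivY_pderivX_eqOn hD hXY)).trans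
    ((pderivY_pderivX_eqOn hD (hY.of_le (by norm_num))).pderivX hD)

/-- The Laplacian of a biharmonic function is harmonic. -/
theorem IsBiharmonicOn.harmonicOnNhd_laplacian {f : ℝ × ℝ → ℝ} {D : Set (ℝ × ℝ)}
    (hD : IsOpen D) (hf : IsBiharmonicOn f D) :
    InnerProductSpace.HarmonicOnNhd
      ((pderivX (pderivX f) + pderivY (pderivY f)) ∘ equivRealProdCLM)
      (equivRealProdCLM ⁻¹' D) := by
  have hX : ContDiffOn ℝ 3 (pderivX f) D := hf.1.pderivX hD (by norm_num)
  have hY : ContDiffOn ℝ 3 (pderivY f) D := hf.1.pderivY hD (by norm_num)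
  have hXX : ContDiffOn ℝ 2 (pderivX (pderivX f)) D := hX.pderivX hD (by norm_num)
  have hYY : ContDiffOn ℝ 2 (pderivY (pderivY f)) D := hY.pderivY hD (by norm_num)
  have hΩ : IsOpen (equivRealProdCLM ⁻¹' D) := hD.preimage equivRealProdCLM.continuous
  intro z hz
  have hat : ∀ w ∈ equivRealProdCLM ⁻¹' D, ∀ g : ℝ × ℝ → ℝ, ContDiffOn ℝ 2 g D →
      ContDiffAt ℝ 2 g (equivRealProdCLM w) := fun w hw g hg ↦
    hg.contDiffAt (hD.mem_nhds hw)
  have hcomp : ∀ g : ℝ × ℝ → ℝ, ContDiffOn ℝ 2 g D → ∀ w ∈ equivRealProdCLM ⁻¹' D,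
      ContDiffAt ℝ 2 (g ∘ equivRealProdCLM) w := fun g hg w hw ↦
    (hat w hw g hg).comp w equivRealProdCLM.contDiff.contDiffAt
  refine ⟨hcomp _ (hXX.add hYY) z hz, ?_⟩
  filter_upwards [hΩ.mem_nhds hz] with w hw
  have hadd := (hcomp _ hXX w hw).laplacian_add (hcomp _ hYY w hw)
  change Laplacian.laplacian
    (pderivX (pderivX f) ∘ equivRealProdCLM + pderivY (pderivY f) ∘ equivRealProdCLM) w = 0
  rw [hadd, (hat w hw _ hXX).laplacian_comp_equivRealProdCLM,
    (hat w hw _ hYY).laplacian_comp_equivRealProdCLM,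
    pderivY_pderivY_pderivX_pderivX_eqOn hD hf.1 hw]
  linear_combination hf.2 _ hw

/-- If `f` is holomorphic then `Δ (y · Im f) = 2 Re f'`. -/
theorem laplacian_im_mul_im {Ω : Set ℂ} (hΩ : IsOpen Ω) {f : ℂ → ℂ}
    (hf : DifferentiableOn ℂ f Ω) {z : ℂ} (hz : z ∈ Ω) :
    ContDiffAt ℝ 2 (fun w ↦ w.im * (f w).im) z ∧
      Laplacian.laplacian (fun w ↦ w.im * (f w).im) z = 2 * (deriv f z).re := by
  have hcd : ContDiffAt ℝ 2 (fun w ↦ w.im * (f w).im) z := by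
    have h : ContDiffAt ℝ 2 f z :=
      ((hf.contDiffOn hΩ (n := 2)).contDiffAt (hΩ.mem_nhds hz)).restrict_scalars ℝ
    exact (imCLM.contDiff.contDiffAt).mul (imCLM.contDiff.contDiffAt.comp z h)
  refine ⟨hcd, ?_⟩
  have hfd : ∀ g : ℂ → ℂ, DifferentiableOn ℂ g Ω → ∀ w ∈ Ω,
      HasFDerivAt (𝕜 := ℝ) g
        ((ContinuousLinearMap.toSpanSingleton ℂ (deriv g w)).restrictScalars ℝ) w :=
    fun g hg w hw ↦
      ((hg.differentiableAt (hΩ.mem_nhds hw)).hasDerivAt.hasFDerivAt).restrictScalars ℝ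
  have hre : ∀ g : ℂ → ℂ, DifferentiableOn ℂ g Ω → ∀ w ∈ Ω,
      HasFDerivAt (fun w ↦ (g w).re) _ w := fun g hg w hw ↦
    reCLM.hasFDerivAt.comp w (hfd g hg w hw)
  have him : ∀ g : ℂ → ℂ, DifferentiableOn ℂ g Ω → ∀ w ∈ Ω,
      HasFDerivAt (fun w ↦ (g w).im) _ w := fun g hg w hw ↦
    imCLM.hasFDerivAt.comp w (hfd g hg w hw)
  have hy : ∀ w : ℂ, HasFDerivAt (fun w : ℂ ↦ w.im) imCLM w := fun w ↦ imCLM.hasFDerivAt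
  have hf' : DifferentiableOn ℂ (deriv f) Ω := hf.deriv hΩ
  have h1 : (fun w ↦ fderiv ℝ (fun w ↦ w.im * (f w).im) w 1) =ᶠ[𝓝 z]
      fun w ↦ w.im * (deriv f w).im := by
    filter_upwards [hΩ.mem_nhds hz] with w hw
    rw [((hy _).fun_mul (him f hf w hw)).fderiv]
    simp
  have hI : (fun w ↦ fderiv ℝ (fun w ↦ w.im * (f w).im) w I) =ᶠ[𝓝 z]
      fun w ↦ (f w).im + w.im * (deriv f w).re := by
    filter_upwards [hΩ.mem_nhds hz] with w hw
    rw [((hy _).fun_mul (him f hf w hw)).fderiv]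
    simp
    ring
  have hA := (hy _).fun_mul (him _ hf' z hz)
  have hB := (him f hf z hz).fun_add ((hy _).fun_mul (hre _ hf' z hz))
  rw [ContDiffAt.laplacian_eq_fderiv_fderiv hcd, h1.fderiv_eq, hI.fderiv_eq, hA.fderiv, hB.fderiv]
  simp
  ring

theorem fst_snd_emb (p : ℝ × ℝ) :
    (emb e₁B e₂B p).fst = p.1 + p.2 * I ∧ (emb e₁B e₂B p).snd = p.1 + 2 * (p.2 * I) := by
  constructor
  · simp [emb, e₁B, e₂B, -Complex.coe_smul]
  · simp [emb, e₁B, e₂B, -Complex.coe_smul]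
    ring

/-- The function `F(z) + (s f(z) + F₀(z)) ε` of `ζ = z + s ε`; it is monogenic when `f` is the
derivative of `F`. -/
def dualLift (F f F₀ : ℂ → ℂ) (ζ : Biharm) : Biharm :=
  TrivSqZeroExt.inl (F ζ.fst) + TrivSqZeroExt.inr (ζ.snd * f ζ.fst + F₀ ζ.fst)

@[simp]
theorem fst_dualLift (F f F₀ : ℂ → ℂ) (ζ : Biharm) : (dualLift F f F₀ ζ).fst = F ζ.fst := by
  simp [dualLift]

@[simp]
theorem snd_dualLift (F f F₀ : ℂ → ℂ) (ζ : Biharm) :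
    (dualLift F f F₀ ζ).snd = ζ.snd * f ζ.fst + F₀ ζ.fst := by
  simp [dualLift]

theorem norm_snd_le_of_mem_biharmPlane {h : Biharm} (hh : h ∈ biharmPlane e₁B e₂B) :
    ‖h.snd‖ ≤ 2 * ‖h.fst‖ := by
  obtain ⟨x, y, rfl⟩ := hh
  obtain ⟨h1, h2⟩ := fst_snd_emb (x, y)
  simp only [emb] at h1 h2
  have hy : ‖(y * I : ℂ)‖ ≤ ‖(x + y * I : ℂ)‖ := by
    simpa using abs_im_le_norm (x + y * I : ℂ)
  rw [h1, h2, show (x + 2 * (y * I) : ℂ) = (x + y * I) + y * I by ring]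
  linarith [norm_add_le (x + y * I : ℂ) (y * I)]

theorem fst_ne_zero_of_mem_biharmPlane {h : Biharm} (hh : h ∈ biharmPlane e₁B e₂B)
    (h0 : h ≠ 0) : h.fst ≠ 0 := by
  intro hf
  have hs := norm_snd_le_of_mem_biharmPlane hh
  rw [hf, norm_zero, mul_zero, norm_le_zero_iff] at hs
  exact h0 (TrivSqZeroExt.ext hf hs)

theorem DualNumber.ring_inverse_eq {h : DualNumber ℂ} (h0 : h.fst ≠ 0) :
    Ring.inverse h = TrivSqZeroExt.inl h.fst⁻¹ + TrivSqZeroExt.inr (-(h.snd / h.fst ^ 2)) := by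
  have hmul : h * (TrivSqZeroExt.inl h.fst⁻¹ + TrivSqZeroExt.inr (-(h.snd / h.fst ^ 2))) = 1 := by
    ext
    · simp [h0]
    · simp
      field_simp
      ring
  have hu : IsUnit h := IsUnit.of_mul_eq_one _ hmul
  have h1 := Ring.inverse_mul_cancel_left h
    (TrivSqZeroExt.inl h.fst⁻¹ + TrivSqZeroExt.inr (-(h.snd / h.fst ^ 2))) hu
  rwa [hmul, mul_one] at h1

theorem hasMonoDerivAt_dualLift {F f F₀ : ℂ → ℂ} {f' F₀' : ℂ} {ζ : Biharm}
    (hF : HasDerivAt F (f ζ.fst) ζ.fst) (hf : HasDerivAt f f' ζ.fst)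
    (hF₀ : HasDerivAt F₀ F₀' ζ.fst) :
    HasMonoDerivAt e₁B e₂B (dualLift F f F₀)
      (TrivSqZeroExt.inl (f ζ.fst) + TrivSqZeroExt.inr (ζ.snd * f' + F₀')) ζ := by
  set l := 𝓝[biharmPlane e₁B e₂B \ {0}] (0 : Biharm)
  have hmem : ∀ᶠ h in l, h ∈ biharmPlane e₁B e₂B \ {0} := self_mem_nhdsWithin
  have hfst : Tendsto (fun h : Biharm ↦ h.fst) l (𝓝[≠] 0) := by
    refine tendsto_nhdsWithin_iff.2 ⟨?_, ?_⟩
    · exact (TrivSqZeroExt.continuous_fst.tendsto' (0 : Biharm) 0 rfl).mono_left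
        nhdsWithin_le_nhds
    · filter_upwards [hmem] with h hh
      exact fst_ne_zero_of_mem_biharmPlane hh.1 hh.2
  have sF := (hasDerivAt_iff_tendsto_slope_zero.1 hF).comp hfst
  have sf := (hasDerivAt_iff_tendsto_slope_zero.1 hf).comp hfst
  have sF₀ := (hasDerivAt_iff_tendsto_slope_zero.1 hF₀).comp hfst
  have cf : Tendsto (fun h : Biharm ↦ f (ζ.fst + h.fst)) l (𝓝 (f ζ.fst)) := by
    refine hf.continuousAt.tendsto.comp ?_
    simpa using (tendsto_nhds_of_tendsto_nhdsWithin hfst).const_add ζ.fst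
  have hbdd : IsBoundedUnder (· ≤ ·) l (fun h : Biharm ↦ ‖h.snd / h.fst‖) := by
    refine isBoundedUnder_of_eventually_le (a := 2) ?_
    filter_upwards [hmem] with h hh
    rw [norm_div, div_le_iff₀ (norm_pos_iff.2 (fst_ne_zero_of_mem_biharmPlane hh.1 hh.2))]
    exact norm_snd_le_of_mem_biharmPlane hh.1
  have hrem := Filter.Tendsto.zero_mul_isBoundedUnder_le
    (by simpa using cf.sub sF) hbdd
  have hsnd := ((sf.const_mul ζ.snd).add sF₀).add hrem
  rw [HasMonoDerivAt, TrivSqZeroExt.nhds_def]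
  set Q := fun h ↦ (dualLift F f F₀ (ζ + h) - dualLift F f F₀ ζ) * Ring.inverse h with hQ
  refine Tendsto.prodMk (f := l) (m₁ := fun h ↦ (Q h).fst) (m₂ := fun h ↦ (Q h).snd) ?_ ?_
  · simp only [TrivSqZeroExt.fst_add, TrivSqZeroExt.fst_inl, TrivSqZeroExt.fst_inr, add_zero]
    refine sF.congr' ?_
    filter_upwards [hmem] with h hh
    simp only [hQ]
    rw [DualNumber.ring_inverse_eq (fst_ne_zero_of_mem_biharmPlane hh.1 hh.2)]
    simp [mul_comm]
  · simp only [TrivSqZeroExt.snd_add, TrivSqZeroExt.snd_inl, TrivSqZeroExt.snd_inr, zero_add]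
    rw [add_zero] at hsnd
    refine hsnd.congr' ?_
    filter_upwards [hmem] with h hh
    have h0 := fst_ne_zero_of_mem_biharmPlane hh.1 hh.2
    simp only [hQ]
    rw [DualNumber.ring_inverse_eq h0]
    simp
    field_simp
    ring

theorem exists_eq_smul_basis (A B : ℂ) : ∃ u₂ u₃ u₄ : ℝ,
    (TrivSqZeroExt.inl A + TrivSqZeroExt.inr B : Biharm) =
      ((2 * A - B).re : ℂ) • e₁B + (u₂ : ℂ) • (I • e₁B) + (u₃ : ℂ) • e₂B
        + (u₄ : ℂ) • (I • e₂B) := by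
  refine ⟨(2 * A - B).im, (-I * (B - A)).re, (-I * (B - A)).im, ?_⟩
  ext
  · apply Complex.ext <;> simp [e₁B, e₂B] <;> ring
  · apply Complex.ext <;> simp [e₁B, e₂B] <;> ring

/-- A biharmonic function is the sum of `y · Im f` and `Re G` for some holomorphic `f`
and `G`. -/
theorem IsBiharmonicOn.exists_differentiableOn {U : ℝ × ℝ → ℝ} {D : Set (ℝ × ℝ)}
    (hD : IsOpen D) (hsc : IsSimplyConnected (equivRealProdCLM ⁻¹' D))
    (hU : IsBiharmonicOn U D) :
    ∃ f G : ℂ → ℂ, DifferentiableOn ℂ f (equivRealProdCLM ⁻¹' D) ∧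
      DifferentiableOn ℂ G (equivRealProdCLM ⁻¹' D) ∧
      ∀ z ∈ equivRealProdCLM ⁻¹' D, U (equivRealProdCLM z) = z.im * (f z).im + (G z).re := by
  have hΩ : IsOpen (equivRealProdCLM ⁻¹' D) := hD.preimage equivRealProdCLM.continuous
  obtain ⟨P, hP, hPre⟩ :=
    (hU.harmonicOnNhd_laplacian hD).exists_differentiableOn_re_eq hΩ hsc
  obtain ⟨f, hf⟩ := (hP.div_const 2).isExactOn_of_isSimplyConnected hΩ hsc
  have hfd : DifferentiableOn ℂ f (equivRealProdCLM ⁻¹' D) := fun z hz ↦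
    (hf z hz).differentiableAt.differentiableWithinAt
  have hU2 : ∀ z ∈ equivRealProdCLM ⁻¹' D, ContDiffAt ℝ 2 U (equivRealProdCLM z) := fun z hz ↦
    (hU.1.contDiffAt (hD.mem_nhds hz)).of_le (by norm_num)
  have hUL : ∀ z ∈ equivRealProdCLM ⁻¹' D, ContDiffAt ℝ 2 (U ∘ equivRealProdCLM) z :=
    fun z hz ↦ (hU2 z hz).comp z equivRealProdCLM.contDiff.contDiffAt
  have hk : InnerProductSpace.HarmonicOnNhd
      (U ∘ equivRealProdCLM - fun z ↦ z.im * (f z).im) (equivRealProdCLM ⁻¹' D) := by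
    intro z hz
    refine ⟨(hUL z hz).sub (laplacian_im_mul_im hΩ hfd hz).1, ?_⟩
    filter_upwards [hΩ.mem_nhds hz] with w hw
    obtain ⟨hc, hl⟩ := laplacian_im_mul_im hΩ hfd hw
    have hw' := hPre w hw
    rw [(hUL w hw).laplacian_sub hc, hl, (hU2 w hw).laplacian_comp_equivRealProdCLM,
      (hf w hw).deriv]
    simp at hw' ⊢
    linarith
  obtain ⟨G, hG, hGre⟩ := hk.exists_differentiableOn_re_eq hΩ hsc
  refine ⟨f, G, hfd, hG, fun z hz ↦ ?_⟩
  simp [hGre z hz]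

/-- Every biharmonic function `U₁` on a bounded simply connected domain `D` is the first
real component of some monogenic function `Φ : D_ζ → 𝔹` for the basis
`e₁ = 1 + ε`, `e₂ = i(1 + 2ε)`. -/
theorem exists_monogenicOn_firstComponent (D : Set (ℝ × ℝ)) (hD : IsOpen D)
    (hDconn : IsConnected D) (hDbdd : Bornology.IsBounded D)
    (hDsc : SimplyConnectedSpace D)
    (U₁ : ℝ × ℝ → ℝ) (hU₁ : IsBiharmonicOn U₁ D) :
    ∃ Φ : Biharm → Biharm, MonogenicOn e₁B e₂B Φ (emb e₁B e₂B '' D) ∧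
      ∀ p ∈ D, ∃ u₂ u₃ u₄ : ℝ, Φ (emb e₁B e₂B p) =
        (U₁ p : ℂ) • e₁B + (u₂ : ℂ) • (Complex.I • e₁B)
          + (u₃ : ℂ) • e₂B + (u₄ : ℂ) • (Complex.I • e₂B) := by
  have hΩ : IsOpen (equivRealProdCLM ⁻¹' D) := hD.preimage equivRealProdCLM.continuous
  have hsc : IsSimplyConnected (equivRealProdCLM ⁻¹' D) :=
    equivRealProdCLM.toHomeomorph.isSimplyConnected_preimage.2 hDsc
  obtain ⟨f, G, hf, hG, hU⟩ := hU₁.exists_differentiableOn hD hsc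
  obtain ⟨F, hF⟩ := hf.isExactOn_of_isSimplyConnected hΩ hsc
  have hFd : DifferentiableOn ℂ F (equivRealProdCLM ⁻¹' D) := fun z hz ↦
    (hF z hz).differentiableAt.differentiableWithinAt
  have hF₀ : DifferentiableOn ℂ (fun z ↦ 2 * F z - z * f z - G z) (equivRealProdCLM ⁻¹' D) :=
    ((hFd.const_mul 2).sub (differentiableOn_id.mul hf)).sub hG
  have hz : ∀ p ∈ D, (emb e₁B e₂B p).fst ∈ equivRealProdCLM ⁻¹' D := fun p hp ↦ by
    simpa [(fst_snd_emb p).1] using hp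
  refine ⟨dualLift F f fun z ↦ 2 * F z - z * f z - G z, ?_, fun p hp ↦ ?_⟩
  · rintro _ ⟨p, hp, rfl⟩
    have hnhds := hΩ.mem_nhds (hz p hp)
    exact ⟨_, hasMonoDerivAt_dualLift (hF _ (hz p hp)) (hf.differentiableAt hnhds).hasDerivAt
      (hF₀.differentiableAt hnhds).hasDerivAt⟩
  · have hUp := hU _ (hz p hp)
    obtain ⟨h1, h2⟩ := fst_snd_emb p
    rw [dualLift, h1, h2]
    rw [h1] at hUp
    convert exists_eq_smul_basis _ _ using 12
    simp at hUp ⊢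
    rw [hUp]
    ring
end
end
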